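/- arXiv:math/0406523 — 4 statements merged into one kernel-verified Lean document; each statement's English description precedes it below -/
import Mathlib

section
/- Suppose the distribution function F satisfies, as x → ∞, 1 − F(x) = c_R x^{−α_R} (1 + b_R x^{−β_R} + o(x^{−β_R})) with c_R > 0, α_R > 1, b_R ≠ 0 and β_R > 0. Then, as x → 0+, F⁻(1 − x) = c_R^{1/α_R} x^{−1/α_R} (1 + d_R x^{ρ_R} + o(x^{ρ_R})), where ρ_R = β_R/α_R and d_R = b_R c_R^{−ρ_R}/α_R; that is, (c_R^{−1/α_R} x^{1/α_R} F⁻(1 − x) − 1)/x^{ρ_R} → d_R as x → 0+. -/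
open Filter Set Topology

/-- The generalized inverse (quantile function) of a distribution function `F`:
`F⁻(u) = inf {x : F x ≥ u}`. -/
noncomputable def quantile (F : ℝ → ℝ) (u : ℝ) : ℝ := sInf {x : ℝ | u ≤ F x}

/-- Second-order right-tail condition: as `x → ∞`,
`1 - F x = c * x^(-α) * (1 + b * x^(-β) + o (x^(-β)))`. -/
def RightTailSecondOrder (F : ℝ → ℝ) (c α b β : ℝ) : Prop :=
  Tendsto (fun x : ℝ => ((1 - F x) / (c * x ^ (-α)) - 1) * x ^ β) atTop (nhds b)

/-- A point whose `F`-value reaches the positive level `u` bounds the quantile from above. -/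
lemma quantile_le_of_le {F : ℝ → ℝ} (hF_mono : Monotone F) (hF_bot : Tendsto F atBot (𝓝 0))
    {u y : ℝ} (hu : 0 < u) (h : u ≤ F y) : quantile F u ≤ y := by
  obtain ⟨m, hm⟩ := (hF_bot.eventually (gt_mem_nhds hu)).exists
  refine csInf_le ⟨m, fun z hz => ?_⟩ h
  by_contra! hlt
  exact absurd (hF_mono hlt.le) (not_le.2 (hm.trans_le hz))

/-- A point whose `F`-value is below the level `u < 1` bounds the quantile from below. -/
lemma le_quantile_of_lt {F : ℝ → ℝ} (hF_mono : Monotone F) (hF_top : Tendsto F atTop (𝓝 1))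
    {u y : ℝ} (hu : u < 1) (h : F y < u) : y ≤ quantile F u := by
  obtain ⟨m, hm⟩ := (hF_top.eventually (lt_mem_nhds hu)).exists
  refine le_csInf ⟨m, hm.le⟩ fun z hz => ?_
  by_contra! hlt
  exact absurd (hF_mono hlt.le) (not_le.2 (h.trans_le hz))

/-- The two-term approximation of the quantile `F⁻(1 - x)`, with coefficient `t` of the
second-order term. -/
noncomputable def quantileApprox (c α β t x : ℝ) : ℝ :=
  c ^ (1 / α) * x ^ (-(1 / α)) * (1 + t * x ^ (β / α))

lemma tendsto_rpow_nhdsGT_zero {r : ℝ} (hr : 0 < r) :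
    Tendsto (fun x : ℝ => x ^ r) (𝓝[>] 0) (𝓝[>] 0) := by
  refine tendsto_nhdsWithin_iff.2 ⟨?_, ?_⟩
  · have := (Real.continuousAt_rpow_const 0 r (Or.inr hr.le)).tendsto
    rw [Real.zero_rpow hr.ne'] at this
    exact this.mono_left nhdsWithin_le_nhds
  · filter_upwards [self_mem_nhdsWithin] with x hx using Real.rpow_pos_of_pos hx r

lemma tendsto_one_add_mul_rpow {r : ℝ} (hr : 0 < r) (t : ℝ) :
    Tendsto (fun x : ℝ => 1 + t * x ^ r) (𝓝[>] 0) (𝓝 1) := by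
  simpa using (((tendsto_rpow_nhdsGT_zero hr).mono_right nhdsWithin_le_nhds).const_mul t).const_add 1

lemma tendsto_quantileApprox_atTop {c α β : ℝ} (hc : 0 < c) (hα : 0 < α) (hβ : 0 < β) (t : ℝ) :
    Tendsto (quantileApprox c α β t) (𝓝[>] 0) atTop := by
  have h1 : Tendsto (fun x : ℝ => x ^ (-(1 / α))) (𝓝[>] 0) atTop := by
    refine Tendsto.congr' ?_
      (tendsto_inv_nhdsGT_zero.comp (tendsto_rpow_nhdsGT_zero (one_div_pos.2 hα)))
    filter_upwards [self_mem_nhdsWithin] with x hx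
    exact (Real.rpow_neg (le_of_lt hx) _).symm
  exact (h1.const_mul_atTop (Real.rpow_pos_of_pos hc _)).atTop_mul_pos one_pos
    (tendsto_one_add_mul_rpow (div_pos hβ hα) t)

lemma quantileApprox_rpow {c α β t x : ℝ} (hc : 0 < c) (hx : 0 < x)
    (ht : 0 < 1 + t * x ^ (β / α)) (r : ℝ) :
    quantileApprox c α β t x ^ r =
      c ^ (r / α) * x ^ (-(r / α)) * (1 + t * x ^ (β / α)) ^ r := by
  have h1 := Real.rpow_nonneg hc.le (1 / α)
  have h2 := Real.rpow_nonneg hx.le (-(1 / α))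
  rw [quantileApprox, Real.mul_rpow (mul_nonneg h1 h2) ht.le, Real.mul_rpow h1 h2,
    ← Real.rpow_mul hc.le, ← Real.rpow_mul hx.le]
  congr 3 <;> ring_nf

lemma tendsto_one_add_rpow_sub_one_div {ρ : ℝ} (hρ : 0 < ρ) (t p : ℝ) :
    Tendsto (fun x : ℝ => ((1 + t * x ^ ρ) ^ p - 1) / x ^ ρ) (𝓝[>] 0) (𝓝 (p * t)) := by
  have hd : HasDerivAt (fun u : ℝ => (1 + t * u) ^ p) (p * t) 0 := by
    have h0 : HasDerivAt (fun u : ℝ => 1 + t * u) t 0 := by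
      simpa using ((hasDerivAt_id (0 : ℝ)).const_mul t).const_add 1
    have := h0.rpow_const (p := p) (Or.inl (by simp))
    simpa [mul_comm] using this
  have hs := (hasDerivAt_iff_tendsto_slope.1 hd).comp
    ((tendsto_rpow_nhdsGT_zero hρ).mono_right (nhdsWithin_mono 0 fun _ hx => ne_of_gt hx))
  refine hs.congr fun x => ?_
  simp [slope_def_field]

/-- Under the second-order tail condition, the tail at the two-term approximation equals
`x * (1 + (b * c ^ (-ρ) - α * t) * x ^ ρ + o(x ^ ρ))`, where `ρ = β / α`. -/
lemma RightTailSecondOrder.tendsto_tail_quantileApprox {F : ℝ → ℝ} {c α b β : ℝ}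
    (htail : RightTailSecondOrder F c α b β) (hc : 0 < c) (hα : 0 < α) (hβ : 0 < β) (t : ℝ) :
    Tendsto (fun x : ℝ => ((1 - F (quantileApprox c α β t x)) / x - 1) / x ^ (β / α))
      (𝓝[>] 0) (𝓝 (b * c ^ (-(β / α)) - α * t)) := by
  have hρ : 0 < β / α := div_pos hβ hα
  have hone := tendsto_one_add_mul_rpow hρ t
  have hA : ∀ p : ℝ, Tendsto (fun x : ℝ => (1 + t * x ^ (β / α)) ^ p) (𝓝[>] 0) (𝓝 1) := by
    intro p
    simpa using hone.rpow_const (p := p) (Or.inl one_ne_zero)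
  have hh := htail.comp (tendsto_quantileApprox_atTop hc hα hβ t)
  have hlim := ((hA (-α)).mul ((hh.mul_const (c ^ (-(β / α)))).mul (hA (-β)))).add
    (tendsto_one_add_rpow_sub_one_div hρ t (-α))
  rw [show 1 * (b * c ^ (-(β / α)) * 1) + -α * t = b * c ^ (-(β / α)) - α * t by ring] at hlim
  refine hlim.congr' ?_
  filter_upwards [self_mem_nhdsWithin, hone.eventually (lt_mem_nhds one_pos)] with x hx ht
  have hx : 0 < x := hx
  have hcρ := Real.rpow_pos_of_pos hc (β / α)
  have hxρ := Real.rpow_pos_of_pos hx (β / α)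
  have hα' := Real.rpow_pos_of_pos ht α
  have hβ' := Real.rpow_pos_of_pos ht β
  have e1 : c * quantileApprox c α β t x ^ (-α) = x * (1 + t * x ^ (β / α)) ^ (-α) := by
    rw [quantileApprox_rpow hc hx ht, neg_div, div_self hα.ne', neg_neg, Real.rpow_one,
      Real.rpow_neg_one]
    field_simp
  simp only [Function.comp_apply]
  rw [e1, quantileApprox_rpow hc hx ht β, Real.rpow_neg hc.le, Real.rpow_neg hx.le,
    Real.rpow_neg ht.le, Real.rpow_neg ht.le]
  generalize x ^ (β / α) = u at *
  generalize (1 + t * u) ^ α = A at *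
  generalize (1 + t * u) ^ β = B at *
  field_simp
  ring

/-- under the second-order right-tail condition with `c > 0`, `α > 1`,
`b ≠ 0`, `β > 0`, the quantile function satisfies, as `x → 0+`,
`F⁻(1 - x) = c^(1/α) x^(-1/α) (1 + d x^ρ + o(x^ρ))` with `ρ = β/α` and
`d = b * c^(-ρ) / α`; that is,
`(c^(-1/α) x^(1/α) F⁻(1-x) - 1) / x^ρ → d` as `x → 0+`. -/
theorem quantile_right_tail_expansion
    (F : ℝ → ℝ) (c α b β : ℝ)
    (hF_mono : Monotone F)
    (hF_rc : ∀ x : ℝ, ContinuousWithinAt F (Ici x) x)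
    (hF_top : Tendsto F atTop (nhds 1))
    (hF_bot : Tendsto F atBot (nhds 0))
    (hc : 0 < c) (hα : 1 < α) (hb : b ≠ 0) (hβ : 0 < β)
    (htail : RightTailSecondOrder F c α b β) :
    Tendsto
      (fun x : ℝ => (c ^ (-(1 / α)) * x ^ (1 / α) * quantile F (1 - x) - 1) / x ^ (β / α))
      (nhdsWithin 0 (Ioi 0))
      (nhds (b * c ^ (-(β / α)) / α)) := by
  have hα0 : 0 < α := one_pos.trans hα
  set d := b * c ^ (-(β / α)) / α with hd
  have hdα : b * c ^ (-(β / α)) = α * d := by rw [hd]; field_simp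
  have hquot : ∀ {x t : ℝ}, 0 < x →
      c ^ (-(1 / α)) * x ^ (1 / α) * quantileApprox c α β t x - 1 = t * x ^ (β / α) := by
    intro x t hx
    have h1 := Real.rpow_pos_of_pos hc (1 / α)
    have h2 := Real.rpow_pos_of_pos hx (1 / α)
    rw [quantileApprox, Real.rpow_neg hc.le, Real.rpow_neg hx.le]
    field_simp
    ring
  have hscale : ∀ {x : ℝ}, 0 < x → 0 < c ^ (-(1 / α)) * x ^ (1 / α) := fun hx =>
    mul_pos (Real.rpow_pos_of_pos hc _) (Real.rpow_pos_of_pos hx _)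
  refine tendsto_order.2 ⟨fun a ha => ?_, fun a ha => ?_⟩
  · obtain ⟨t, hat, htd⟩ := exists_between ha
    have hpos : 0 < b * c ^ (-(β / α)) - α * t := by rw [hdα]; nlinarith
    filter_upwards [self_mem_nhdsWithin,
      (htail.tendsto_tail_quantileApprox hc hα0 hβ t).eventually (lt_mem_nhds hpos)]
      with x (hx : 0 < x) hlt
    have hxρ := Real.rpow_pos_of_pos hx (β / α)
    have h1 : 1 < (1 - F (quantileApprox c α β t x)) / x := by
      linarith [(div_pos_iff_of_pos_right hxρ).1 hlt]
    rw [one_lt_div hx] at h1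
    have hq := le_quantile_of_lt hF_mono hF_top (u := 1 - x) (by linarith)
      (show F (quantileApprox c α β t x) < 1 - x by linarith)
    refine hat.trans_le ((le_div_iff₀ hxρ).2 ?_)
    rw [← hquot hx]
    exact sub_le_sub_right (mul_le_mul_of_nonneg_left hq (hscale hx).le) 1
  · obtain ⟨t, hdt, hta⟩ := exists_between ha
    have hneg : b * c ^ (-(β / α)) - α * t < 0 := by rw [hdα]; nlinarith
    filter_upwards [self_mem_nhdsWithin,
      (htail.tendsto_tail_quantileApprox hc hα0 hβ t).eventually (gt_mem_nhds hneg),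
      nhdsWithin_le_nhds (gt_mem_nhds one_pos)] with x (hx : 0 < x) hlt hx1
    have hxρ := Real.rpow_pos_of_pos hx (β / α)
    have h1 : (1 - F (quantileApprox c α β t x)) / x < 1 := by
      linarith [(div_lt_iff₀ hxρ).1 hlt]
    rw [div_lt_one hx] at h1
    have hq := quantile_le_of_le hF_mono hF_bot (u := 1 - x) (by linarith)
      (show 1 - x ≤ F (quantileApprox c α β t x) by linarith)
    refine ((div_le_iff₀ hxρ).2 ?_).trans_lt hta
    rw [← hquot hx]
    exact sub_le_sub_right (mul_le_mul_of_nonneg_left hq (hscale hx).le) 1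
end

section
/- Suppose the distribution function F satisfies, as x → ∞, F(−x) = c_L x^{−α_L} (1 + b_L x^{−β_L} + o(x^{−β_L})) with c_L > 0, α_L > 1, b_L ≠ 0 and β_L > 0. Then, as x → 0+, F⁻(x) = −c_L^{1/α_L} x^{−1/α_L} (1 + d_L x^{ρ_L} + o(x^{ρ_L})), where ρ_L = β_L/α_L and d_L = b_L c_L^{−ρ_L}/α_L; that is, (−c_L^{−1/α_L} x^{1/α_L} F⁻(x) − 1)/x^{ρ_L} → d_L as x → 0+. -/
open Filter Set Topology

/-- Second-order left-tail condition: as `x → ∞`,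
`F (-x) = c * x^(-α) * (1 + b * x^(-β) + o (x^(-β)))`. -/
def LeftTailSecondOrder (F : ℝ → ℝ) (c α b β : ℝ) : Prop :=
  Tendsto (fun x : ℝ => (F (-x) / (c * x ^ (-α)) - 1) * x ^ β) atTop (nhds b)

lemma tendsto_one_add_mul_rpow_sub_one_div (p d : ℝ) :
    Tendsto (fun s : ℝ => ((1 + d * s) ^ p - 1) / s) (𝓝[>] 0) (𝓝 (p * d)) := by
  have h : HasDerivAt (fun s : ℝ => (1 + d * s) ^ p) (p * d) 0 := by
    have h1 : HasDerivAt (fun s : ℝ => 1 + d * s) d 0 := by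
      simpa using ((hasDerivAt_id (0 : ℝ)).const_mul d).const_add 1
    have h2 := h1.rpow_const (p := p) (Or.inl (by simp))
    convert h2 using 1
    simp [mul_comm]
  have h3 := (hasDerivAt_iff_tendsto_slope.1 h).mono_left
    (nhdsWithin_mono 0 (fun x hx => (mem_Ioi.1 hx).ne' : Ioi (0 : ℝ) ⊆ {0}ᶜ))
  refine h3.congr fun s => ?_
  simp [slope_def_field]

lemma tendsto_rpow_nhdsGT_zero_s1 {p : ℝ} (hp : 0 < p) :
    Tendsto (fun u : ℝ => u ^ p) (𝓝[>] 0) (𝓝[>] 0) := by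
  refine tendsto_nhdsWithin_iff.2 ⟨?_, ?_⟩
  · have h := (Real.continuousAt_rpow_const 0 p (Or.inr hp.le)).tendsto
    rw [Real.zero_rpow hp.ne'] at h
    exact h.mono_left nhdsWithin_le_nhds
  · filter_upwards [self_mem_nhdsWithin] with u hu
    exact Real.rpow_pos_of_pos hu p

lemma tendsto_one_add_mul_rpow_nhdsGT_zero (d p : ℝ) :
    Tendsto (fun s : ℝ => (1 + d * s) ^ p) (𝓝[>] 0) (𝓝 1) := by
  have h : ContinuousAt (fun s : ℝ => (1 + d * s) ^ p) 0 :=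
    ContinuousAt.rpow_const (by fun_prop) (Or.inl (by simp))
  simpa using h.tendsto.mono_left (nhdsWithin_le_nhds (s := Ioi 0))

/-- Second-order behaviour of `F` along the trial points `-c^(1/α) u^(-1/α) (1 + d u^(β/α))`. -/
lemma LeftTailSecondOrder.tendsto_trial {F : ℝ → ℝ} {c α b β : ℝ}
    (htail : LeftTailSecondOrder F c α b β) (hc : 0 < c) (hα : 0 < α) (hβ : 0 < β) (d : ℝ) :
    Tendsto
      (fun u : ℝ =>
        (F (-(c ^ (1 / α) * u ^ (-(1 / α)) * (1 + d * u ^ (β / α)))) / u - 1) / u ^ (β / α))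
      (𝓝[>] 0) (𝓝 (b * c ^ (-(β / α)) - α * d)) := by
  have hs := tendsto_rpow_nhdsGT_zero_s1 (div_pos hβ hα)
  have hw : ∀ p : ℝ, Tendsto (fun u : ℝ => (1 + d * u ^ (β / α)) ^ p) (𝓝[>] 0) (𝓝 1) :=
    fun p => (tendsto_one_add_mul_rpow_nhdsGT_zero d p).comp hs
  have hw1 : Tendsto (fun u : ℝ => 1 + d * u ^ (β / α)) (𝓝[>] 0) (𝓝 1) := by
    simpa using hw 1
  have hu : Tendsto (fun u : ℝ => u ^ (-(1 / α))) (𝓝[>] 0) atTop := by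
    refine (tendsto_rpow_nhdsGT_zero_s1 (one_div_pos.2 hα)).inv_tendsto_nhdsGT_zero.congr' ?_
    filter_upwards [self_mem_nhdsWithin] with u hu
    simp [Real.rpow_neg (mem_Ioi.1 hu).le]
  have ht : Tendsto (fun u : ℝ => c ^ (1 / α) * u ^ (-(1 / α)) * (1 + d * u ^ (β / α)))
      (𝓝[>] 0) atTop :=
    (hu.const_mul_atTop (Real.rpow_pos_of_pos hc _)).atTop_mul_pos one_pos hw1
  have h1 := (tendsto_one_add_mul_rpow_sub_one_div (-α) d).comp hs
  have h2 := ((hw (-α)).mul (Tendsto.comp htail ht)).mul ((hw (-β)).const_mul (c ^ (-(β / α))))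
  have h3 := h1.add h2
  have he : -α * d + 1 * b * (c ^ (-(β / α)) * 1) = b * c ^ (-(β / α)) - α * d := by ring
  rw [he] at h3
  refine h3.congr' ?_
  filter_upwards [self_mem_nhdsWithin, hw1.eventually_const_lt one_pos] with u hu hwu
  have hu : 0 < u := hu
  simp only [Function.comp_apply]
  set w := 1 + d * u ^ (β / α) with hwdef
  have hpow : ∀ p : ℝ, (c ^ (1 / α) * u ^ (-(1 / α)) * w) ^ p
      = c ^ (p / α) * u ^ (-(p / α)) * w ^ p := by
    intro p
    rw [Real.mul_rpow (by positivity) hwu.le, Real.mul_rpow (by positivity) (by positivity),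
      ← Real.rpow_mul hc.le, ← Real.rpow_mul hu.le]
    congr 3 <;> ring_nf
  rw [hpow β, hpow (-α)]
  have e1 : -α / α = -1 := by field_simp
  rw [e1, neg_neg, Real.rpow_one, Real.rpow_neg_one, Real.rpow_neg hc.le, Real.rpow_neg hu.le (β / α),
    Real.rpow_neg hwu.le, Real.rpow_neg hwu.le]
  have p1 := Real.rpow_pos_of_pos hc (β / α)
  have p2 := Real.rpow_pos_of_pos hu (β / α)
  have p3 := Real.rpow_pos_of_pos hwu α
  have p4 := Real.rpow_pos_of_pos hwu β
  field_simp
  ring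

lemma bddBelow_setOf_le_of_tendsto_atBot {F : ℝ → ℝ} (hF : Monotone F)
    (hF_bot : Tendsto F atBot (𝓝 0)) {u : ℝ} (hu : 0 < u) : BddBelow {x : ℝ | u ≤ F x} := by
  obtain ⟨y, hy⟩ := (hF_bot.eventually_lt_const hu).exists
  exact ⟨y, fun x hx => (hF.reflect_lt (hy.trans_le hx)).le⟩

lemma le_quantile {F : ℝ → ℝ} (hF : Monotone F) (hF_top : Tendsto F atTop (𝓝 1)) {u y : ℝ}
    (hu : u < 1) (hy : F y < u) : y ≤ quantile F u := by
  obtain ⟨z, hz⟩ := (hF_top.eventually_const_lt hu).exists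
  exact le_csInf ⟨z, hz.le⟩ fun x hx => (hF.reflect_lt (hy.trans_le hx)).le

/-- under the second-order left-tail condition with `c > 0`, `α > 1`,
`b ≠ 0`, `β > 0`, the quantile function satisfies, as `x → 0+`,
`F⁻(x) = -c^(1/α) x^(-1/α) (1 + d x^ρ + o(x^ρ))` with `ρ = β/α` and
`d = b * c^(-ρ) / α`; that is,
`(-c^(-1/α) x^(1/α) F⁻(x) - 1) / x^ρ → d` as `x → 0+`. -/
theorem quantile_left_tail_expansion
    (F : ℝ → ℝ) (c α b β : ℝ)
    (hF_mono : Monotone F)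
    (hF_rc : ∀ x : ℝ, ContinuousWithinAt F (Ici x) x)
    (hF_top : Tendsto F atTop (nhds 1))
    (hF_bot : Tendsto F atBot (nhds 0))
    (hc : 0 < c) (hα : 1 < α) (hb : b ≠ 0) (hβ : 0 < β)
    (htail : LeftTailSecondOrder F c α b β) :
    Tendsto
      (fun x : ℝ => (-(c ^ (-(1 / α))) * x ^ (1 / α) * quantile F x - 1) / x ^ (β / α))
      (nhdsWithin 0 (Ioi 0))
      (nhds (b * c ^ (-(β / α)) / α)) := by
  have hα0 : 0 < α := one_pos.trans hα
  have hnorm : ∀ u : ℝ, 0 < u → ∀ d : ℝ,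
      (-(c ^ (-(1 / α))) * u ^ (1 / α) *
        -(c ^ (1 / α) * u ^ (-(1 / α)) * (1 + d * u ^ (β / α))) - 1) / u ^ (β / α) = d := by
    intro u hu d
    have p1 := Real.rpow_pos_of_pos hc (1 / α)
    have p2 := Real.rpow_pos_of_pos hu (1 / α)
    have p3 := Real.rpow_pos_of_pos hu (β / α)
    rw [Real.rpow_neg hc.le, Real.rpow_neg hu.le]
    field_simp
    ring
  have hanti : ∀ u : ℝ, 0 < u → ∀ p q : ℝ, p ≤ q →
      (-(c ^ (-(1 / α))) * u ^ (1 / α) * q - 1) / u ^ (β / α) ≤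
        (-(c ^ (-(1 / α))) * u ^ (1 / α) * p - 1) / u ^ (β / α) := by
    intro u hu p q hpq
    have h : 0 ≤ c ^ (-(1 / α)) * u ^ (1 / α) := by positivity
    refine div_le_div_of_nonneg_right ?_ (by positivity)
    linarith [mul_le_mul_of_nonneg_left hpq h]
  refine tendsto_order.2 ⟨fun a ha => ?_, fun a ha => ?_⟩
  · obtain ⟨d, had, hd⟩ := exists_between ha
    have hlim : 0 < b * c ^ (-(β / α)) - α * d := by
      rw [lt_div_iff₀ hα0] at hd
      linarith
    filter_upwards [self_mem_nhdsWithin,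
      (htail.tendsto_trial hc hα0 hβ d).eventually_const_lt hlim] with u hu hlt
    have hu : 0 < u := hu
    rw [div_pos_iff_of_pos_right (Real.rpow_pos_of_pos hu _), sub_pos, one_lt_div hu] at hlt
    have hq := csInf_le (bddBelow_setOf_le_of_tendsto_atBot hF_mono hF_bot hu) hlt.le
    exact had.trans_le ((hnorm u hu d).symm.le.trans (hanti u hu _ _ hq))
  · obtain ⟨d, hd, hda⟩ := exists_between ha
    have hlim : b * c ^ (-(β / α)) - α * d < 0 := by
      rw [div_lt_iff₀ hα0] at hd
      linarith
    filter_upwards [self_mem_nhdsWithin, Ioo_mem_nhdsGT (one_pos : (0 : ℝ) < 1),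
      (htail.tendsto_trial hc hα0 hβ d).eventually_lt_const hlim] with u hu hu1 hlt
    have hu : 0 < u := hu
    rw [div_lt_iff₀ (Real.rpow_pos_of_pos hu _), zero_mul, sub_neg, div_lt_one hu] at hlt
    have hq := le_quantile hF_mono hF_top hu1.2 hlt
    exact ((hanti u hu _ _ hq).trans (hnorm u hu d).le).trans_lt hda
end

section
/- Suppose F satisfies the second-order tail conditions with α_R ≥ 2 and α_L ≥ 2. Then the ratio σ²(m/n, k/n) / ∫_{m/n}^{1−k/n} [F⁻(s)]² ds converges, as n → ∞, to a strictly positive finite limit. -/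
open Filter Set Topology MeasureTheory

/-- The Lebesgue–Stieltjes measure associated to a nondecreasing function `g`
(junk value `0` if `g` is not monotone). -/
noncomputable def lsMeasure (g : ℝ → ℝ) : Measure ℝ :=
  open scoped Classical in
  if hg : Monotone g then hg.stieltjesFunction.measure else 0

/-- The quantile function of `F` clamped to `[s, 1 - t]`: a nondecreasing function of `u`
that agrees with `F⁻` on `[s, 1 - t]`. -/
noncomputable def clampedQuantile (F : ℝ → ℝ) (s t u : ℝ) : ℝ :=
  quantile F (max s (min u (1 - t)))

/-- `σ²(s,t) = ∫_s^{1-t} ∫_s^{1-t} (u ∧ v - u v) dF⁻(u) dF⁻(v)`, the double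
Lebesgue–Stieltjes integral over `(s, 1-t]` with respect to the nondecreasing
function `F⁻`. -/
noncomputable def sigmaSq (F : ℝ → ℝ) (s t : ℝ) : ℝ :=
  ∫ u in Ioc s (1 - t), ∫ v in Ioc s (1 - t), (min u v - u * v)
    ∂(lsMeasure (clampedQuantile F s t)) ∂(lsMeasure (clampedQuantile F s t))

/-- `F` is a distribution function: nondecreasing, right-continuous, with limits
`0` at `-∞` and `1` at `+∞`. -/
structure IsDistributionFunction (F : ℝ → ℝ) : Prop where
  mono : Monotone F
  right_continuous : ∀ x : ℝ, ContinuousWithinAt F (Ici x) x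
  tendsto_atTop : Tendsto F atTop (nhds 1)
  tendsto_atBot : Tendsto F atBot (nhds 0)

theorem IsDistributionFunction.quantile_le_iff {F : ℝ → ℝ} (hF : IsDistributionFunction F)
    {u : ℝ} (hu : u ∈ Ioo (0 : ℝ) 1) (x : ℝ) : quantile F u ≤ x ↔ u ≤ F x := by
  have hne : {x : ℝ | u ≤ F x}.Nonempty := by
    obtain ⟨x, hx⟩ := (hF.tendsto_atTop.eventually (lt_mem_nhds hu.2)).exists
    exact ⟨x, hx.le⟩
  have hbdd : BddBelow {x : ℝ | u ≤ F x} := by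
    obtain ⟨y, hy⟩ := (hF.tendsto_atBot.eventually (gt_mem_nhds hu.1)).exists
    refine ⟨y, fun x hx => ?_⟩
    by_contra! h
    exact absurd (hF.mono h.le) (not_le.2 (hy.trans_le hx))
  refine ⟨fun h => ?_, fun h => csInf_le hbdd h⟩
  have hq : u ≤ F (quantile F u) := by
    have hlim : Tendsto F (𝓝[>] (quantile F u)) (𝓝 (F (quantile F u))) :=
      (hF.right_continuous _).mono_left (nhdsWithin_mono _ Ioi_subset_Ici_self)
    refine ge_of_tendsto hlim ?_
    filter_upwards [self_mem_nhdsWithin] with y hy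
    obtain ⟨z, hz, hzy⟩ := exists_lt_of_csInf_lt hne (show sInf {x : ℝ | u ≤ F x} < y from hy)
    exact le_trans hz (hF.mono hzy.le)
  exact hq.trans (hF.mono h)

theorem IsDistributionFunction.monotoneOn_quantile {F : ℝ → ℝ}
    (hF : IsDistributionFunction F) : MonotoneOn (quantile F) (Ioo 0 1) := by
  intro u hu v hv huv
  rw [hF.quantile_le_iff hu]
  exact huv.trans ((hF.quantile_le_iff hv _).1 le_rfl)

/-- The correction factor in a second-order expansion tends to `1`. -/
theorem tendsto_one_of_tendsto_sub_one_mul_rpow {r : ℝ → ℝ} {b β : ℝ} (hβ : 0 < β)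
    (h : Tendsto (fun x : ℝ => (r x - 1) * x ^ β) atTop (𝓝 b)) : Tendsto r atTop (𝓝 1) := by
  have h0 : Tendsto (fun x : ℝ => (r x - 1) * x ^ β * x ^ (-β)) atTop (𝓝 (b * 0)) :=
    h.mul (tendsto_rpow_neg_atTop hβ)
  have h1 : Tendsto (fun x : ℝ => (r x - 1) * x ^ β * x ^ (-β) + 1) atTop (𝓝 (b * 0 + 1)) :=
    h0.add_const 1
  rw [mul_zero, zero_add] at h1
  refine h1.congr' ?_
  filter_upwards [eventually_gt_atTop 0] with x hx
  rw [mul_assoc, ← Real.rpow_add hx]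
  simp

/-- A function with regularly varying decay of index `-α`, `α ≥ 2`, is eventually positive and
bounded by a multiple of `x⁻²`. -/
theorem eventually_pos_and_sq_mul_le {G : ℝ → ℝ} {c α : ℝ} (hc : 0 < c) (hα : 2 ≤ α)
    (h : Tendsto (fun x : ℝ => G x / (c * x ^ (-α))) atTop (𝓝 1)) :
    ∀ᶠ x in atTop, 0 < G x ∧ G x * x ^ 2 ≤ 2 * c := by
  filter_upwards [h.eventually (lt_mem_nhds (zero_lt_one)),
    h.eventually (gt_mem_nhds (one_lt_two)), eventually_ge_atTop 1] with x h1 h2 hx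
  have hx0 : 0 < x := by linarith
  have hd : 0 < c * x ^ (-α) := mul_pos hc (Real.rpow_pos_of_pos hx0 _)
  have hG : 0 < G x := (div_pos_iff_of_pos_right hd).1 h1
  refine ⟨hG, ?_⟩
  rw [div_lt_iff₀ hd] at h2
  have h3 : x ^ (-α) * x ^ 2 ≤ 1 := by
    rw [← Real.rpow_natCast, ← Real.rpow_add hx0]
    exact Real.rpow_le_one_of_one_le_of_nonpos hx (by push_cast; linarith)
  calc G x * x ^ 2 ≤ 2 * (c * x ^ (-α)) * x ^ 2 := by gcongr
    _ = 2 * c * (x ^ (-α) * x ^ 2) := by ring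
    _ ≤ 2 * c * 1 := by gcongr
    _ = 2 * c := by ring

/-- Under quadratic tail bounds, `u (1 - u) F⁻(u)²` is bounded. -/
theorem IsDistributionFunction.exists_mul_quantile_sq_le {F : ℝ → ℝ}
    (hF : IsDistributionFunction F) {A B : ℝ}
    (hL : ∀ᶠ x in atTop, F (-x) * x ^ 2 ≤ A) (hR : ∀ᶠ x in atTop, (1 - F x) * x ^ 2 ≤ B) :
    ∃ K : ℝ, ∀ u ∈ Ioo (0 : ℝ) 1, u * (1 - u) * quantile F u ^ 2 ≤ K := by
  obtain ⟨M, hM⟩ := eventually_atTop.1 (hL.and hR)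
  refine ⟨max (M ^ 2) (max A B), fun u hu => ?_⟩
  obtain ⟨hu0, hu1⟩ := hu
  have hmul : ∀ z : ℝ, u * (1 - u) * z ^ 2 ≤ u * z ^ 2 ∧
      u * (1 - u) * z ^ 2 ≤ (1 - u) * z ^ 2 ∧ u * (1 - u) * z ^ 2 ≤ z ^ 2 := by
    intro z
    have := sq_nonneg z
    refine ⟨?_, ?_, ?_⟩
    · exact mul_le_mul_of_nonneg_right (by nlinarith) this
    · exact mul_le_mul_of_nonneg_right (by nlinarith) this
    · exact mul_le_of_le_one_left this (by nlinarith)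
  set q := quantile F u with hq
  rcases le_or_gt q (-M) with h | h
  · refine le_max_of_le_right (le_max_of_le_left ?_)
    have h1 := (hM (-q) (by linarith)).1
    have h2 : u ≤ F q := (hF.quantile_le_iff ⟨hu0, hu1⟩ _).1 le_rfl
    rw [neg_neg, neg_sq] at h1
    exact ((hmul q).1.trans (mul_le_mul_of_nonneg_right h2 (sq_nonneg q))).trans h1
  rcases le_or_gt q M with h' | h'
  · refine le_max_of_le_left ((hmul q).2.2.trans ?_)
    exact sq_le_sq' h.le h'
  · refine le_max_of_le_right (le_max_of_le_right ((hmul q).2.1.trans ?_))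
    have hlim : Tendsto (fun y : ℝ => (1 - u) * y ^ 2) (𝓝[<] q) (𝓝 ((1 - u) * q ^ 2)) :=
      ((continuous_const.mul (continuous_id.pow 2)).tendsto q).mono_left nhdsWithin_le_nhds
    refine le_of_tendsto hlim ?_
    filter_upwards [Ioo_mem_nhdsLT h'] with y hy
    have h1 := (hM y hy.1.le).2
    have h2 : F y < u := by
      by_contra! hc
      exact absurd ((hF.quantile_le_iff ⟨hu0, hu1⟩ y).2 hc) (not_le.2 hy.2)
    exact (mul_le_mul_of_nonneg_right (by linarith) (sq_nonneg y)).trans h1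

/-- If `F` charges every left half-line, its quantile function tends to `-∞` at `0`. -/
theorem IsDistributionFunction.exists_quantile_le {F : ℝ → ℝ} (hF : IsDistributionFunction F)
    (hL : ∀ᶠ x in atTop, 0 < F (-x)) (y : ℝ) :
    ∃ ε ∈ Ioo (0 : ℝ) 1, ∀ u ∈ Ioc 0 ε, quantile F u ≤ y := by
  obtain ⟨x, hx, hxy⟩ := (hL.and (eventually_ge_atTop (-y))).exists
  refine ⟨min (F (-x)) (1 / 2), ⟨by positivity, (min_le_right _ _).trans_lt (by norm_num)⟩, ?_⟩
  intro u hu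
  have h1 : u ≤ F (-x) := hu.2.trans (min_le_left _ _)
  have h2 : u ≤ 1 / 2 := hu.2.trans (min_le_right _ _)
  exact ((hF.quantile_le_iff ⟨hu.1, by linarith⟩ _).2 h1).trans (by linarith)

/-- If `F` charges every right half-line, its quantile function tends to `∞` at `1`. -/
theorem IsDistributionFunction.exists_le_quantile {F : ℝ → ℝ} (hF : IsDistributionFunction F)
    (hR : ∀ᶠ x in atTop, 0 < 1 - F x) (y : ℝ) :
    ∃ ε ∈ Ioo (0 : ℝ) 1, ∀ u ∈ Ioc 0 ε, y ≤ quantile F (1 - u) := by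
  obtain ⟨x, hx, hxy⟩ := (hR.and (eventually_ge_atTop y)).exists
  refine ⟨min ((1 - F x) / 2) (1 / 2), ⟨by positivity,
    (min_le_right _ _).trans_lt (by norm_num)⟩, ?_⟩
  intro u hu
  have h1 : u ≤ (1 - F x) / 2 := hu.2.trans (min_le_left _ _)
  have h2 : u ≤ 1 / 2 := hu.2.trans (min_le_right _ _)
  by_contra! hc
  have := (hF.quantile_le_iff (u := 1 - u) ⟨by linarith, by linarith [hu.1]⟩ x).1 (by linarith)
  linarith

/-- Layer-cake formula with a bounded weight for a finite measure. -/
theorem integral_setIntegral_indicator_Iio (μ : Measure ℝ) [IsFiniteMeasure μ] {φ : ℝ → ℝ}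
    (hφ : Measurable φ) {C : ℝ} (hC : ∀ w, ‖φ w‖ ≤ C) :
    ∫ u, (∫ w in Ioc (0 : ℝ) 1, (Iio u).indicator φ w) ∂μ
      = ∫ w in Ioc (0 : ℝ) 1, φ w * μ.real (Ioi w) := by
  have hmeas : Measurable (fun p : ℝ × ℝ => (Iio p.1).indicator φ p.2) := by
    have : (fun p : ℝ × ℝ => (Iio p.1).indicator φ p.2)
        = {p : ℝ × ℝ | p.2 < p.1}.indicator (fun p => φ p.2) := by
      ext p
      simp [indicator]
    rw [this]
    exact (hφ.comp measurable_snd).indicator (measurableSet_lt measurable_snd measurable_fst)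
  have hint : Integrable (Function.uncurry fun u w : ℝ => (Iio u).indicator φ w)
      (μ.prod (volume.restrict (Ioc (0 : ℝ) 1))) := by
    refine Integrable.of_bound hmeas.aestronglyMeasurable C (ae_of_all _ fun p => ?_)
    exact (norm_indicator_le_norm_self _ _).trans (hC _)
  rw [integral_integral_swap hint]
  refine integral_congr_ae (ae_of_all _ fun w => ?_)
  have : (fun u : ℝ => (Iio u).indicator φ w) = (Ioi w).indicator (fun _ => φ w) := by
    ext u
    simp [indicator]
  simp only [this]
  rw [integral_indicator measurableSet_Ioi]
  simp [mul_comm]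

theorem setIntegral_indicator_Iio {u : ℝ} (hu : u ≤ 1) (f : ℝ → ℝ) :
    ∫ w in Ioc (0 : ℝ) 1, (Iio u).indicator f w = ∫ w in Ioc (0 : ℝ) u, f w := by
  rw [setIntegral_indicator measurableSet_Iio, ← integral_Ioc_eq_integral_Ioo.symm]
  congr 2
  ext w
  simp only [mem_inter_iff, mem_Ioc, mem_Iio, mem_Ioo]
  constructor
  · rintro ⟨⟨h1, h2⟩, h3⟩
    exact ⟨h1, h3⟩
  · rintro ⟨h1, h3⟩
    exact ⟨⟨h1, by linarith⟩, h3⟩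

/-- For a finite measure carried by `(0, 1]`, the double integral of the covariance kernel of the
Brownian bridge is the variance of the tail function under the uniform law. -/
theorem integral_integral_min_sub_mul (μ : Measure ℝ) [IsFiniteMeasure μ]
    (hμ : ∀ᵐ u ∂μ, u ∈ Ioc (0 : ℝ) 1) :
    ∫ u, ∫ v, (min u v - u * v) ∂μ ∂μ
      = (∫ w in Ioc (0 : ℝ) 1, μ.real (Ioi w) ^ 2)
        - (∫ w in Ioc (0 : ℝ) 1, μ.real (Ioi w)) ^ 2 := by
  set h : ℝ → ℝ := fun w => μ.real (Ioi w) with hh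
  have hanti : Antitone h := fun a b hab => measureReal_mono (Ioi_subset_Ioi hab)
  have hmeas : Measurable h := hanti.measurable
  have hbd : ∀ w, ‖h w‖ ≤ μ.real univ := fun w => by
    rw [Real.norm_of_nonneg measureReal_nonneg]
    exact measureReal_mono (subset_univ _)
  set H := ∫ w in Ioc (0 : ℝ) 1, h w with hH
  have hbdid : ∀ᵐ u ∂μ, ‖u‖ ≤ 1 := by
    filter_upwards [hμ] with u hu
    rw [Real.norm_of_nonneg hu.1.le]
    exact hu.2
  have hid : Integrable (fun u : ℝ => u) μ :=
    Integrable.of_bound measurable_id.aestronglyMeasurable 1 hbdid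
  have hmin : ∀ u ∈ Ioc (0 : ℝ) 1, ∫ v, min u v ∂μ
      = ∫ w in Ioc (0 : ℝ) 1, (Iio u).indicator h w := by
    intro u hu
    have h1 := integral_setIntegral_indicator_Iio μ
      (φ := (Iio u).indicator fun _ => (1 : ℝ)) (measurable_const.indicator measurableSet_Iio)
      (C := 1) (fun w => (norm_indicator_le_norm_self _ _).trans (by simp))
    have h2 : ∀ w, (Iio u).indicator (fun _ => (1 : ℝ)) w * h w = (Iio u).indicator h w := by
      intro w
      simp [indicator]
    change _ = ∫ w in Ioc (0 : ℝ) 1, (Iio u).indicator (fun _ => (1 : ℝ)) w * h w at h1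
    simp only [h2] at h1
    rw [← h1]
    refine integral_congr_ae ?_
    filter_upwards [hμ] with v hv
    rw [setIntegral_indicator_Iio hv.2, setIntegral_indicator measurableSet_Iio]
    have : (Ioc 0 v ∩ Iio u : Set ℝ) =ᵐ[volume] Ioc 0 (min u v) := by
      have h3 : (Ioc 0 v ∩ Iio u : Set ℝ) =ᵐ[volume] (Ioc 0 v ∩ Iic u : Set ℝ) :=
        ae_eq_set_inter (ae_eq_refl _) Iio_ae_eq_Iic
      rw [Ioc_inter_Iic, min_comm] at h3
      exact h3
    rw [setIntegral_congr_set this]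
    simp [(lt_min hu.1 hv.1).le]
  have hmean : ∫ u, u ∂μ = H := by
    have h1 := integral_setIntegral_indicator_Iio μ (φ := fun _ => (1 : ℝ)) measurable_const
      (C := 1) (fun w => by simp)
    simp only [one_mul] at h1
    rw [hH, ← h1]
    refine integral_congr_ae ?_
    filter_upwards [hμ] with u hu
    rw [setIntegral_indicator_Iio hu.2]
    simp [hu.1.le]
  have hinner : ∀ᵐ u ∂μ, ∫ v, (min u v - u * v) ∂μ
      = (∫ w in Ioc (0 : ℝ) 1, (Iio u).indicator h w) - u * H := by
    filter_upwards [hμ] with u hu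
    rw [integral_sub, hmin u hu, integral_const_mul, hmean]
    · exact (integrable_const u).inf hid
    · exact hid.const_mul u
  rw [integral_congr_ae hinner, integral_sub, integral_mul_const, hmean,
    integral_setIntegral_indicator_Iio μ hmeas hbd]
  · simp only [sq, hh]
  · have hae : (fun u => ∫ w in Ioc (0 : ℝ) 1, (Iio u).indicator h w)
        =ᵐ[μ] fun u => ∫ v, min u v ∂μ := by
      filter_upwards [hμ] with u hu using (hmin u hu).symm
    refine Integrable.congr (Integrable.of_bound (C := μ.real univ) ?_ ?_) hae.symm
    · exact (measurable_fst.min measurable_snd).stronglyMeasurable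
        |>.integral_prod_right.aestronglyMeasurable
    · filter_upwards [hμ] with u hu
      refine (norm_integral_le_of_norm_le_const (C := 1) ?_).trans (by simp)
      filter_upwards [hμ] with v hv
      rw [Real.norm_of_nonneg (le_min hu.1.le hv.1.le)]
      exact min_le_of_left_le hu.2
  · exact hid.mul_const H

theorem Monotone.intervalIntegrable_comp {Y : ℝ → ℝ} (hY : Monotone Y) {φ : ℝ → ℝ}
    (hφ : Continuous φ) (a b : ℝ) : IntervalIntegrable (fun w => φ (Y w)) volume a b := by
  obtain ⟨C, hC⟩ := isCompact_Icc.exists_bound_of_continuousOn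
    (hφ.continuousOn (s := Icc (Y (min a b)) (Y (max a b))))
  rw [intervalIntegrable_iff]
  refine Measure.integrableOn_of_bounded (M := C) (by simp [uIoc])
    (hφ.measurable.comp hY.measurable).aestronglyMeasurable ?_
  filter_upwards [ae_restrict_mem measurableSet_uIoc] with w hw
  exact hC _ ⟨hY hw.1.le, hY hw.2⟩

theorem variance_shift {Y : ℝ → ℝ} (hY : Monotone Y) (b : ℝ) :
    (∫ w in (0 : ℝ)..1, (b - Y w) ^ 2) - (∫ w in (0 : ℝ)..1, (b - Y w)) ^ 2
      = (∫ w in (0 : ℝ)..1, Y w ^ 2) - (∫ w in (0 : ℝ)..1, Y w) ^ 2 := by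
  have h1 : IntervalIntegrable Y volume 0 1 := hY.intervalIntegrable_comp continuous_id 0 1
  have h2 : IntervalIntegrable (fun w => Y w ^ 2) volume 0 1 :=
    hY.intervalIntegrable_comp (continuous_pow 2) 0 1
  have e : ∀ w, (b - Y w) ^ 2 = b ^ 2 - 2 * b * Y w + Y w ^ 2 := fun w => by ring
  simp only [e]
  rw [intervalIntegral.integral_add (intervalIntegrable_const.sub (h1.const_mul _)) h2,
    intervalIntegral.integral_sub intervalIntegrable_const (h1.const_mul _),
    intervalIntegral.integral_sub intervalIntegrable_const h1,
    intervalIntegral.integral_const_mul]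
  simp
  ring

/-- The integral of a function of a Winsorized monotone function. -/
theorem integral_comp_of_ae_eq {Y q : ℝ → ℝ} (hY : Monotone Y) {s r a b : ℝ} (hs : 0 < s)
    (hsr : s < r) (hr : r < 1) (hYs : ∀ w ≤ s, Y w = a) (hYr : ∀ w, r ≤ w → Y w = b)
    (hYq : ∀ᵐ w, w ∈ Ioc s r → Y w = q w) {φ : ℝ → ℝ} (hφ : Continuous φ) :
    ∫ w in (0 : ℝ)..1, φ (Y w) = s * φ a + (∫ w in s..r, φ (q w)) + (1 - r) * φ b := by
  have hi := fun x y => hY.intervalIntegrable_comp hφ x y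
  rw [← intervalIntegral.integral_add_adjacent_intervals (hi 0 r) (hi r 1),
    ← intervalIntegral.integral_add_adjacent_intervals (hi 0 s) (hi s r)]
  congr 1
  · congr 1
    · rw [intervalIntegral.integral_congr (g := fun _ => φ a)]
      · simp
      · intro w hw
        rw [uIcc_of_le hs.le] at hw
        simp only [hYs w hw.2]
    · refine intervalIntegral.integral_congr_ae ?_
      filter_upwards [hYq] with w hw hmem
      rw [uIoc_of_le hsr.le] at hmem
      rw [hw hmem]
  · rw [intervalIntegral.integral_congr (g := fun _ => φ b)]
    · simp
    · intro w hw
      rw [uIcc_of_le hr.le] at hw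
      simp only [hYr w hw.1]

theorem IsDistributionFunction.monotone_clampedQuantile {F : ℝ → ℝ}
    (hF : IsDistributionFunction F) {s t : ℝ} (hs : 0 < s) (ht : 0 < t) (hst : s < 1 - t) :
    Monotone (clampedQuantile F s t) := by
  intro u v huv
  have hmem : ∀ x, max s (min x (1 - t)) ∈ Ioo (0 : ℝ) 1 := fun x =>
    ⟨hs.trans_le (le_max_left _ _),
      max_lt (by linarith) ((min_le_right _ _).trans_lt (by linarith))⟩
  exact hF.monotoneOn_quantile (hmem u) (hmem v) (by gcongr)

/-- `σ²(s,t)` is the variance of a Winsorized quantile function under the uniform law. -/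
theorem IsDistributionFunction.exists_sigmaSq_eq {F : ℝ → ℝ} (hF : IsDistributionFunction F)
    {s t : ℝ} (hs : 0 < s) (ht : 0 < t) (hs2 : s < 1 / 2) (ht2 : t < 1 / 2) :
    ∃ a, quantile F s ≤ a ∧ a ≤ quantile F (1 / 2) ∧
      sigmaSq F s t = s * a ^ 2 + (∫ u in s..(1 - t), quantile F u ^ 2)
          + t * quantile F (1 - t) ^ 2
        - (s * a + (∫ u in s..(1 - t), quantile F u) + t * quantile F (1 - t)) ^ 2 := by
  set r := 1 - t with hr
  have hsr : s < r := by linarith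
  have hr1 : r < 1 := by linarith
  set g := clampedQuantile F s t with hg
  have hmono : Monotone g := hF.monotone_clampedQuantile hs ht hsr
  set G := hmono.stieltjesFunction with hG
  have hgq : ∀ w ∈ Icc s r, g w = quantile F w := fun w hw => by
    simp only [hg, clampedQuantile, ← hr, min_eq_left hw.2, max_eq_right hw.1]
  have hgr : ∀ w, r ≤ w → g w = quantile F r := fun w hw => by
    simp only [hg, clampedQuantile, ← hr, min_eq_right hw, max_eq_right hsr.le]
  have hGr : ∀ w, r ≤ w → G w = quantile F r := fun w hw => by
    refine le_antisymm ?_ ?_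
    · exact (hmono.rightLim_le (lt_add_one w)).trans (hgr _ (by linarith)).le
    · exact (hgr w hw).ge.trans (hmono.le_rightLim le_rfl)
  set Y : ℝ → ℝ := fun w => G (max s w) with hYdef
  have hY : Monotone Y := fun x y hxy => G.mono (by gcongr)
  have hYs : ∀ w ≤ s, Y w = G s := fun w hw => by simp only [hYdef, max_eq_left hw]
  have hYr : ∀ w, r ≤ w → Y w = quantile F r := fun w hw =>
    hGr _ (hw.trans (le_max_right _ _))
  have hYq : ∀ᵐ w, w ∈ Ioc s r → Y w = quantile F w := by
    filter_upwards [hmono.countable_not_continuousAt.ae_notMem volume] with w hw hmem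
    simp only [not_not] at hw
    rw [← hgq w ⟨hmem.1.le, hmem.2⟩]
    simp only [hYdef, max_eq_right hmem.1.le]
    exact hmono.continuousWithinAt_Ioi_iff_rightLim_eq.1 hw.continuousWithinAt
  have hls : lsMeasure g = G.measure := by
    simp only [lsMeasure, dif_pos hmono, hG]
  set μ := G.measure.restrict (Ioc s r) with hμ
  have : IsFiniteMeasure μ := ⟨by simp [hμ, StieltjesFunction.measure_Ioc]⟩
  have hμmem : ∀ᵐ u ∂μ, u ∈ Ioc (0 : ℝ) 1 := by
    filter_upwards [ae_restrict_mem measurableSet_Ioc] with u hu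
    exact ⟨hs.trans hu.1, hu.2.trans hr1.le⟩
  have htail : ∀ w, μ.real (Ioi w) = quantile F r - Y w := by
    intro w
    have h1 : Ioi w ∩ Ioc s r = Ioc (max s w) r := by
      rw [inter_comm, Ioc_inter_Ioi]
    have h2 : G r = quantile F r := hGr r le_rfl
    rw [measureReal_def, hμ, Measure.restrict_apply measurableSet_Ioi, h1,
      StieltjesFunction.measure_Ioc, h2]
    refine ENNReal.toReal_ofReal (sub_nonneg.2 ?_)
    rcases le_total r (max s w) with h | h
    · exact (hGr _ h).le
    · exact (G.mono h).trans h2.le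
  refine ⟨G s, ?_, ?_, ?_⟩
  · exact (hgq s ⟨le_rfl, hsr.le⟩).ge.trans (hmono.le_rightLim le_rfl)
  · exact (hmono.rightLim_le hs2).trans (hgq (1 / 2) ⟨hs2.le, by linarith⟩).le
  · have h1 := integral_integral_min_sub_mul μ hμmem
    simp only [htail] at h1
    have h2 := integral_comp_of_ae_eq hY hs hsr hr1 hYs hYr hYq continuous_id
    simp only [id] at h2
    rw [sigmaSq, ← hg, hls, ← hr]
    rw [h1, ← intervalIntegral.integral_of_le zero_le_one,
      ← intervalIntegral.integral_of_le zero_le_one, variance_shift hY,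
      integral_comp_of_ae_eq hY hs hsr hr1 hYs hYr hYq (continuous_pow 2), h2]
    simp only [hr, sub_sub_cancel]

theorem integrableOn_of_mul_sq_le {q : ℝ → ℝ} (hq : MonotoneOn q (Ioo 0 1)) {K : ℝ}
    (hK : ∀ u ∈ Ioo (0 : ℝ) 1, u * (1 - u) * q u ^ 2 ≤ K) : IntegrableOn q (Ioo 0 1) := by
  have h1 : IntervalIntegrable (fun u : ℝ => u ^ (-(1 / 2) : ℝ)) volume 0 1 :=
    intervalIntegral.intervalIntegrable_rpow' (by norm_num)
  have h2 : IntervalIntegrable (fun u : ℝ => (1 - u) ^ (-(1 / 2) : ℝ)) volume 0 1 := by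
    simpa using (h1.comp_sub_left 1).symm
  have h3 := ((h1.add h2).const_mul √K)
  rw [intervalIntegrable_iff_integrableOn_Ioo_of_le zero_le_one] at h3
  refine Integrable.mono' h3
    (aemeasurable_restrict_of_monotoneOn measurableSet_Ioo hq).aestronglyMeasurable ?_
  filter_upwards [ae_restrict_mem measurableSet_Ioo] with u hu
  have hu0 : 0 < u := hu.1
  have hu1 : 0 < 1 - u := sub_pos.2 hu.2
  have hK0 : 0 ≤ K := le_trans (by positivity) (hK u hu)
  have hsq : ∀ x : ℝ, 0 < x → (x ^ (-(1 / 2) : ℝ)) ^ 2 = x⁻¹ := fun x hx => by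
    rw [← Real.rpow_natCast, ← Real.rpow_mul hx.le, ← Real.rpow_neg_one]
    norm_num
  have hA := Real.rpow_pos_of_pos hu0 (-(1 / 2))
  have hB := Real.rpow_pos_of_pos hu1 (-(1 / 2))
  have hA2 := hsq u hu0
  have hB2 := hsq (1 - u) hu1
  rw [Real.norm_eq_abs]
  change |q u| ≤ √K * (u ^ (-(1 / 2) : ℝ) + (1 - u) ^ (-(1 / 2) : ℝ))
  refine abs_le_of_sq_le_sq ?_ (by positivity)
  have h4 : q u ^ 2 ≤ K * (u⁻¹ + (1 - u)⁻¹) := by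
    have h5 : u⁻¹ + (1 - u)⁻¹ = (u * (1 - u))⁻¹ := by field_simp; ring
    rw [h5, ← div_eq_mul_inv, le_div_iff₀ (by positivity), mul_comm]
    exact hK u hu
  refine h4.trans ?_
  rw [mul_pow, Real.sq_sqrt hK0, add_sq, hA2, hB2]
  refine mul_le_mul_of_nonneg_left ?_ hK0
  have : 0 < 2 * u ^ (-(1 / 2) : ℝ) * (1 - u) ^ (-(1 / 2) : ℝ) := by positivity
  linarith

/-- Lower bounds for an integrable function on shrinking intervals are negligible against the
length of the interval. -/
theorem tendsto_mul_zero_of_le_on {ι : Type*} {l : Filter ι} {f : ℝ → ℝ}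
    (hf : IntegrableOn f (Ioo 0 1)) {x s c : ι → ℝ} (hs : Tendsto s l (𝓝 0))
    (h : ∀ᶠ n in l, 0 ≤ s n ∧ 0 ≤ c n ∧ Ioo (x n) (x n + s n) ⊆ Ioo 0 1 ∧
      ∀ u ∈ Ioo (x n) (x n + s n), c n ≤ f u) :
    Tendsto (fun n => s n * c n) l (𝓝 0) := by
  have hvol : Tendsto ((volume.restrict (Ioo (0 : ℝ) 1)) ∘ fun n => Ioo (x n) (x n + s n)) l
      (𝓝 0) := by
    have h1 : Tendsto (fun n => ENNReal.ofReal (s n)) l (𝓝 0) := by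
      simpa using ENNReal.tendsto_ofReal hs
    refine tendsto_of_tendsto_of_tendsto_of_le_of_le tendsto_const_nhds h1
      (fun _ => zero_le) fun n => ?_
    refine (Measure.restrict_apply_le _ _).trans ?_
    simp
  have hlim := Integrable.tendsto_setIntegral_nhds_zero hf hvol
  refine tendsto_of_tendsto_of_tendsto_of_le_of_le' tendsto_const_nhds hlim ?_ ?_
  · filter_upwards [h] with n hn using mul_nonneg hn.1 hn.2.1
  · filter_upwards [h] with n hn
    obtain ⟨h0, hc, hsub, hle⟩ := hn
    rw [Measure.restrict_restrict measurableSet_Ioo, inter_eq_left.2 hsub]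
    have h2 := setIntegral_ge_of_const_le_real (μ := volume) measurableSet_Ioo (by simp) hle
      (hf.mono_set hsub)
    simp only [Real.volume_real_Ioo, add_sub_cancel_left, max_eq_left h0] at h2
    linarith

theorem tendsto_mul_zero_of_mul_sq_le {ι : Type*} {l : Filter ι} {x y : ι → ℝ} {K : ℝ}
    (hx : Tendsto x l (𝓝 0)) (hpos : ∀ᶠ n in l, 0 < x n)
    (h : ∀ᶠ n in l, x n * y n ^ 2 ≤ K) : Tendsto (fun n => x n * y n) l (𝓝 0) := by
  have hlim : Tendsto (fun n => √(x n * K)) l (𝓝 0) := by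
    simpa using (hx.mul_const K).sqrt
  refine squeeze_zero_norm' ?_ hlim
  filter_upwards [hpos, h] with n h0 h1
  refine Real.abs_le_sqrt ?_
  calc (x n * y n) ^ 2 = x n * (x n * y n ^ 2) := by ring
    _ ≤ x n * K := by gcongr

theorem tendsto_intervalIntegral_of_integrableOn_Ioo {ι : Type*} {l : Filter ι}
    [l.IsCountablyGenerated] {f : ℝ → ℝ} (hf : IntegrableOn f (Ioo 0 1)) {s r : ι → ℝ}
    (hs : Tendsto s l (𝓝 0)) (hr : Tendsto r l (𝓝 1))
    (hsr : ∀ᶠ n in l, 0 < s n ∧ s n ≤ r n ∧ r n < 1) :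
    Tendsto (fun n => ∫ u in s n..r n, f u) l (𝓝 (∫ u in Ioo 0 1, f u)) := by
  have h := (aecover_Ioo_of_Ioc (μ := volume) hs hr).integral_tendsto_of_countably_generated hf
  refine h.congr' ?_
  filter_upwards [hsr] with n hn
  have hsub : Ioc (s n) (r n) ⊆ Ioo 0 1 := fun u hu => ⟨hn.1.trans hu.1, hu.2.trans_lt hn.2.2⟩
  rw [intervalIntegral.integral_of_le hn.2.1, Measure.restrict_restrict measurableSet_Ioc,
    inter_eq_left.2 hsub]

theorem tendsto_intervalIntegral_sq_atTop {ι : Type*} {l : Filter ι}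
    [l.IsCountablyGenerated] {q : ℝ → ℝ} (hq : MonotoneOn q (Ioo 0 1))
    (hf : ¬ IntegrableOn (fun u => q u ^ 2) (Ioo 0 1)) {s r : ι → ℝ}
    (hs : Tendsto s l (𝓝 0)) (hr : Tendsto r l (𝓝 1))
    (hsr : ∀ᶠ n in l, 0 < s n ∧ s n ≤ r n ∧ r n < 1) :
    Tendsto (fun n => ∫ u in s n..r n, q u ^ 2) l atTop := by
  have hmeas : AEMeasurable (fun u => q u ^ 2) (volume.restrict (Ioo 0 1)) :=
    (aemeasurable_restrict_of_monotoneOn measurableSet_Ioo hq).pow_const 2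
  have htop : ∫⁻ u in Ioo 0 1, ENNReal.ofReal (q u ^ 2) = ⊤ := by
    by_contra hne
    refine hf ⟨hmeas.aestronglyMeasurable, ?_⟩
    rw [hasFiniteIntegral_iff_ofReal (ae_of_all _ fun u => sq_nonneg _)]
    exact lt_top_iff_ne_top.2 hne
  have h := (aecover_Ioo_of_Ioc (μ := volume) hs hr).lintegral_tendsto_of_countably_generated
    hmeas.ennreal_ofReal
  rw [htop] at h
  refine ENNReal.tendsto_ofReal_nhds_top.1 (h.congr' ?_)
  filter_upwards [hsr] with n hn
  have hsub : Ioc (s n) (r n) ⊆ Ioo 0 1 := fun u hu => ⟨hn.1.trans hu.1, hu.2.trans_lt hn.2.2⟩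
  have hIcc : Icc (s n) (r n) ⊆ Ioo 0 1 := fun u hu =>
    ⟨hn.1.trans_le hu.1, hu.2.trans_lt hn.2.2⟩
  have hint : IntegrableOn (fun u => q u ^ 2) (Ioc (s n) (r n)) := by
    have hqi : ∀ u ∈ Icc (s n) (r n), |q u| ≤ max |q (s n)| |q (r n)| := fun u hu =>
      abs_le_max_abs_abs (hq (hIcc ⟨le_rfl, hn.2.1⟩) (hIcc hu) hu.1)
        (hq (hIcc hu) (hIcc ⟨hn.2.1, le_rfl⟩) hu.2)
    refine Integrable.of_bound
      (hmeas.mono_measure (Measure.restrict_mono hsub le_rfl)).aestronglyMeasurable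
      (max |q (s n)| |q (r n)| ^ 2) ?_
    filter_upwards [ae_restrict_mem measurableSet_Ioc] with u hu
    rw [norm_pow, Real.norm_eq_abs]
    exact pow_le_pow_left₀ (abs_nonneg _) (hqi u (Ioc_subset_Icc_self hu)) 2
  rw [intervalIntegral.integral_of_le hn.2.1, Measure.restrict_restrict measurableSet_Ioc,
    inter_eq_left.2 hsub,
    ofReal_integral_eq_lintegral_ofReal hint (ae_of_all _ fun u => sq_nonneg _)]

/-- Strict positivity of the variance of a function that is not essentially constant. -/
theorem sq_integral_lt_integral_sq {q : ℝ → ℝ} (hq : IntegrableOn q (Ioo 0 1))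
    (hq2 : IntegrableOn (fun u => q u ^ 2) (Ioo 0 1))
    (hneg : ∀ y, ∃ ε ∈ Ioo (0 : ℝ) 1, ∀ u ∈ Ioc 0 ε, q u ≤ y) :
    (∫ u in Ioo 0 1, q u) ^ 2 < ∫ u in Ioo 0 1, q u ^ 2 := by
  set M := ∫ u in Ioo 0 1, q u with hM
  have e : ∀ u, (q u - M) ^ 2 = q u ^ 2 - 2 * M * q u + M ^ 2 := fun u => by ring
  have hc : IntegrableOn (fun _ : ℝ => M ^ 2) (Ioo 0 1) := by simp
  have hlin : IntegrableOn (fun u => q u ^ 2 - 2 * M * q u) (Ioo 0 1) :=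
    hq2.sub (hq.const_mul _)
  have hint : IntegrableOn (fun u => (q u - M) ^ 2) (Ioo 0 1) := by
    simp only [e]
    exact hlin.add hc
  have hval : ∫ u in Ioo 0 1, (q u - M) ^ 2 = (∫ u in Ioo 0 1, q u ^ 2) - M ^ 2 := by
    simp only [e]
    rw [integral_add hlin hc, integral_sub hq2 (hq.const_mul _),
      integral_const_mul, ← hM]
    simp
    ring
  have hpos : 0 < ∫ u in Ioo 0 1, (q u - M) ^ 2 := by
    rw [setIntegral_pos_iff_support_of_nonneg_ae (ae_of_all _ fun u => sq_nonneg _) hint]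
    obtain ⟨ε, hε, hle⟩ := hneg (M - 1)
    have hsub : Ioo 0 ε ⊆ Function.support (fun u => (q u - M) ^ 2) ∩ Ioo 0 1 := by
      intro u hu
      have h1 := hle u ⟨hu.1, hu.2.le⟩
      refine ⟨?_, hu.1, hu.2.trans hε.2⟩
      have h2 : q u - M < 0 := by linarith
      exact pow_ne_zero 2 h2.ne
    refine lt_of_lt_of_le ?_ (measure_mono hsub)
    simpa using hε.1
  linarith

theorem mul_sq_le_two_mul {u z K : ℝ} (hu0 : 0 < u) (hu : u < 1 / 2)
    (h : u * (1 - u) * z ^ 2 ≤ K) : u * z ^ 2 ≤ 2 * K := by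
  have h1 : 0 ≤ u * z ^ 2 := by positivity
  nlinarith

theorem IsDistributionFunction.exists_tendsto_sigmaSq_div {F : ℝ → ℝ}
    (hF : IsDistributionFunction F) {K : ℝ}
    (hK : ∀ u ∈ Ioo (0 : ℝ) 1, u * (1 - u) * quantile F u ^ 2 ≤ K)
    (hneg : ∀ y, ∃ ε ∈ Ioo (0 : ℝ) 1, ∀ u ∈ Ioc 0 ε, quantile F u ≤ y)
    (hpos : ∀ y, ∃ ε ∈ Ioo (0 : ℝ) 1, ∀ u ∈ Ioc 0 ε, y ≤ quantile F (1 - u))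
    {ι : Type*} {l : Filter ι} [l.NeBot] [l.IsCountablyGenerated] {s t : ι → ℝ}
    (hs : Tendsto s l (𝓝 0)) (ht : Tendsto t l (𝓝 0))
    (hs0 : ∀ᶠ n in l, 0 < s n) (ht0 : ∀ᶠ n in l, 0 < t n) :
    ∃ C : ℝ, 0 < C ∧ Tendsto (fun n => sigmaSq F (s n) (t n) /
      ∫ u in s n..(1 - t n), quantile F u ^ 2) l (𝓝 C) := by
  set q := quantile F with hqdef
  have hq : MonotoneOn q (Ioo 0 1) := hF.monotoneOn_quantile
  have hqi : IntegrableOn q (Ioo 0 1) := integrableOn_of_mul_sq_le hq hK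
  have hsmall : ∀ᶠ n in l, s n ∈ Ioo (0 : ℝ) (1 / 2) ∧ t n ∈ Ioo (0 : ℝ) (1 / 2) := by
    filter_upwards [hs0, ht0, hs.eventually (gt_mem_nhds (show (0 : ℝ) < 1 / 2 by norm_num)),
      ht.eventually (gt_mem_nhds (show (0 : ℝ) < 1 / 2 by norm_num))] with n h1 h2 h3 h4
    exact ⟨⟨h1, h3⟩, h2, h4⟩
  have hr : Tendsto (fun n => 1 - t n) l (𝓝 1) := by simpa using ht.const_sub 1
  have hsr : ∀ᶠ n in l, 0 < s n ∧ s n ≤ 1 - t n ∧ 1 - t n < 1 := by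
    filter_upwards [hsmall] with n hn
    exact ⟨hn.1.1, by linarith [hn.1.2, hn.2.2], by linarith [hn.2.1]⟩
  have hvar : ∀ᶠ n in l, ∃ x, q (s n) ≤ x ∧ x ≤ q (1 / 2) ∧
      sigmaSq F (s n) (t n) = s n * x ^ 2 + (∫ u in s n..(1 - t n), q u ^ 2)
          + t n * q (1 - t n) ^ 2
        - (s n * x + (∫ u in s n..(1 - t n), q u) + t n * q (1 - t n)) ^ 2 := by
    filter_upwards [hsmall] with n hn
    exact hF.exists_sigmaSq_eq hn.1.1 hn.2.1 hn.1.2 hn.2.2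
  obtain ⟨a, ha⟩ := hvar.choice
  have hsq : ∀ᶠ n in l, s n * q (s n) ^ 2 ≤ 2 * K := by
    filter_upwards [hsmall] with n hn
    exact mul_sq_le_two_mul hn.1.1 hn.1.2 (hK _ ⟨hn.1.1, by linarith [hn.1.2]⟩)
  have htq : ∀ᶠ n in l, t n * q (1 - t n) ^ 2 ≤ 2 * K := by
    filter_upwards [hsmall] with n hn
    refine mul_sq_le_two_mul hn.2.1 hn.2.2 ?_
    have := hK (1 - t n) ⟨by linarith [hn.2.2], by linarith [hn.2.1]⟩
    rw [sub_sub_cancel] at this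
    linarith
  have hsa_le : ∀ᶠ n in l, s n * a n ^ 2 ≤ s n * q (s n) ^ 2 + s n * q (1 / 2) ^ 2 := by
    filter_upwards [ha, hs0] with n hn h0
    rw [← mul_add]
    refine mul_le_mul_of_nonneg_left ?_ h0.le
    rcases le_total 0 (a n) with h | h
    · nlinarith [hn.2.1, sq_nonneg (q (s n))]
    · nlinarith [hn.1, sq_nonneg (q (1 / 2))]
  have hsa : ∀ᶠ n in l, s n * a n ^ 2 ≤ 2 * K + q (1 / 2) ^ 2 := by
    filter_upwards [hsa_le, hsq, hsmall] with n h1 h2 hn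
    nlinarith [hn.1.2, sq_nonneg (q (1 / 2))]
  have hD : Tendsto (fun n => (s n * a n + (∫ u in s n..(1 - t n), q u) + t n * q (1 - t n)) ^ 2)
      l (𝓝 ((∫ u in Ioo 0 1, q u) ^ 2)) := by
    have := (((tendsto_mul_zero_of_mul_sq_le hs hs0 hsa).add
      (tendsto_intervalIntegral_of_integrableOn_Ioo hqi hs hr hsr)).add
      (tendsto_mul_zero_of_mul_sq_le ht ht0 htq)).pow 2
    simpa using this
  by_cases hq2 : IntegrableOn (fun u => q u ^ 2) (Ioo 0 1)
  · have hlt := sq_integral_lt_integral_sq hqi hq2 hneg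
    have hI := tendsto_intervalIntegral_of_integrableOn_Ioo hq2 hs hr hsr
    have hJ : 0 < ∫ u in Ioo 0 1, q u ^ 2 := (sq_nonneg _).trans_lt hlt
    have hleft : Tendsto (fun n => s n * q (s n) ^ 2) l (𝓝 0) := by
      obtain ⟨ε, hε, hle⟩ := hneg 0
      refine tendsto_mul_zero_of_le_on hq2 (x := fun _ => 0) hs ?_
      filter_upwards [hsmall, hs.eventually (gt_mem_nhds hε.1)] with n hn hnε
      refine ⟨hn.1.1.le, sq_nonneg _, fun u hu => ⟨hu.1, ?_⟩, fun u hu => ?_⟩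
      · linarith [hu.2, hn.1.2]
      · rw [zero_add] at hu
        have h1 := hle (s n) ⟨hn.1.1, hnε.le⟩
        have h2 := hq ⟨hu.1, by linarith [hu.2, hn.1.2]⟩
          ⟨hn.1.1, by linarith [hn.1.2]⟩ hu.2.le
        nlinarith
    have hright : Tendsto (fun n => t n * q (1 - t n) ^ 2) l (𝓝 0) := by
      obtain ⟨ε, hε, hle⟩ := hpos 0
      refine tendsto_mul_zero_of_le_on hq2 (x := fun n => 1 - t n) ht ?_
      filter_upwards [hsmall, ht.eventually (gt_mem_nhds hε.1)] with n hn hnε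
      rw [sub_add_cancel]
      refine ⟨hn.2.1.le, sq_nonneg _, fun u hu => ⟨?_, hu.2⟩, fun u hu => ?_⟩
      · linarith [hu.1, hn.2.2]
      · have h1 := hle (t n) ⟨hn.2.1, hnε.le⟩
        have h2 := hq ⟨by linarith [hn.2.2], by linarith [hn.2.1]⟩
          ⟨by linarith [hu.1, hn.2.2], hu.2⟩ hu.1.le
        nlinarith
    have hleft' : Tendsto (fun n => s n * a n ^ 2) l (𝓝 0) := by
      have hub : Tendsto (fun n => s n * q (s n) ^ 2 + s n * q (1 / 2) ^ 2) l (𝓝 0) := by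
        simpa using hleft.add (hs.mul_const (q (1 / 2) ^ 2))
      refine tendsto_of_tendsto_of_tendsto_of_le_of_le' tendsto_const_nhds hub ?_ hsa_le
      filter_upwards [hs0] with n h0
      positivity
    refine ⟨((∫ u in Ioo 0 1, q u ^ 2) - (∫ u in Ioo 0 1, q u) ^ 2) / ∫ u in Ioo 0 1, q u ^ 2,
      div_pos (sub_pos.2 hlt) hJ, Tendsto.div ?_ hI hJ.ne'⟩
    have := ((hleft'.add hI).add hright).sub hD
    rw [zero_add, add_zero] at this
    refine this.congr' ?_
    filter_upwards [ha] with n hn using hn.2.2.symm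
  · have hI := tendsto_intervalIntegral_sq_atTop hq hq2 hs hr hsr
    refine ⟨1, one_pos, ?_⟩
    have h1 : Tendsto (fun n => (s n * a n ^ 2 + t n * q (1 - t n) ^ 2) /
        ∫ u in s n..(1 - t n), q u ^ 2) l (𝓝 0) := by
      refine tendsto_of_tendsto_of_tendsto_of_le_of_le' tendsto_const_nhds
        (tendsto_const_nhds (x := 4 * K + q (1 / 2) ^ 2) |>.div_atTop hI) ?_ ?_
      · filter_upwards [hs0, ht0, hI.eventually_gt_atTop 0] with n h1 h2 h3
        positivity
      · filter_upwards [hsa, htq, hI.eventually_gt_atTop 0] with n h1 h2 h3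
        exact div_le_div_of_nonneg_right (by linarith) h3.le
    have h2 := (h1.add_const 1).sub (hD.div_atTop hI)
    rw [zero_add, sub_zero] at h2
    refine h2.congr' ?_
    filter_upwards [ha, hI.eventually_gt_atTop 0] with n hn h3
    rw [hn.2.2]
    field_simp
    ring

/-- under the second-order tail conditions with `α_R ≥ 2` and `α_L ≥ 2`,
the ratio `σ²(m/n, k/n) / ∫_{m/n}^{1-k/n} [F⁻(s)]² ds` converges, as `n → ∞`, to a
strictly positive finite limit. -/
theorem sigmaSq_ratio_tendsto_of_two_le_two_le
    (F : ℝ → ℝ) (cR cL bR bL αR αL βR βL : ℝ)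
    (hF : IsDistributionFunction F)
    (hcR : 0 < cR) (hcL : 0 < cL) (hbR : bR ≠ 0) (hbL : bL ≠ 0)
    (hβR : 0 < βR) (hβL : 0 < βL) (hαR1 : 1 < αR) (hαL1 : 1 < αL)
    (htailR : RightTailSecondOrder F cR αR bR βR)
    (htailL : LeftTailSecondOrder F cL αL bL βL)
    (hαR : 2 ≤ αR) (hαL : 2 ≤ αL)
    (m k : ℕ → ℕ)
    (hm_top : Tendsto m atTop atTop)
    (hm_frac : Tendsto (fun n : ℕ => (m n : ℝ) / n) atTop (nhds 0))
    (hk_top : Tendsto k atTop atTop)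
    (hk_frac : Tendsto (fun n : ℕ => (k n : ℝ) / n) atTop (nhds 0)) :
    ∃ C : ℝ, 0 < C ∧
      Tendsto
        (fun n : ℕ =>
          sigmaSq F ((m n : ℝ) / n) ((k n : ℝ) / n) /
            ∫ s in ((m n : ℝ) / n)..(1 - (k n : ℝ) / n), (quantile F s) ^ 2)
        atTop (nhds C) := by
  have hL := eventually_pos_and_sq_mul_le (G := fun x => F (-x)) hcL hαL
    (tendsto_one_of_tendsto_sub_one_mul_rpow hβL htailL)
  have hR := eventually_pos_and_sq_mul_le (G := fun x => 1 - F x) hcR hαR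
    (tendsto_one_of_tendsto_sub_one_mul_rpow hβR htailR)
  obtain ⟨K, hK⟩ := hF.exists_mul_quantile_sq_le (hL.mono fun _ h => h.2)
    (hR.mono fun _ h => h.2)
  have hfrac : ∀ {j : ℕ → ℕ}, Tendsto j atTop atTop → ∀ᶠ n in atTop, 0 < (j n : ℝ) / n := by
    intro j hj
    filter_upwards [hj.eventually_gt_atTop 0, eventually_gt_atTop 0] with n h1 h2
    positivity
  exact hF.exists_tendsto_sigmaSq_div hK (hF.exists_quantile_le (hL.mono fun _ h => h.1))
    (hF.exists_le_quantile (hR.mono fun _ h => h.1)) hm_frac hk_frac (hfrac hm_top)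
    (hfrac hk_top)
end

section
/- Suppose F satisfies the second-order tail conditions with α_R > 2 and α_L < 2. Then there is a strictly positive finite constant C_L, depending only on c_L and α_L, such that σ²(m/n, k/n) / (m/n)^{1−2/α_L} → C_L as n → ∞. -/
open Filter Set Topology MeasureTheory

lemma quantile_le {F : ℝ → ℝ} (hF : IsDistributionFunction F) {u x : ℝ} (hu : 0 < u)
    (h : u ≤ F x) : quantile F u ≤ x := by
  refine csInf_le ?_ h
  obtain ⟨y, hy⟩ := (hF.tendsto_atBot.eventually (gt_mem_nhds hu)).exists
  refine ⟨y, fun z hz => ?_⟩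
  by_contra! hzy
  exact absurd (lt_of_le_of_lt (hF.mono hzy.le) hy) (not_lt.2 hz)

lemma le_quantile_s4 {F : ℝ → ℝ} (hF : IsDistributionFunction F) {u x : ℝ} (hu : u < 1)
    (h : F x < u) : x ≤ quantile F u := by
  obtain ⟨y, hy⟩ := (hF.tendsto_atTop.eventually (lt_mem_nhds hu)).exists
  refine le_csInf ⟨y, hy.le⟩ fun z hz => ?_
  by_contra! hzx
  exact absurd (lt_of_le_of_lt (hF.mono hzx.le) h) (not_lt.2 hz)

lemma quantile_mono {F : ℝ → ℝ} (hF : IsDistributionFunction F) {u v : ℝ} (hu : 0 < u)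
    (hv : v < 1) (huv : u ≤ v) : quantile F u ≤ quantile F v := by
  obtain ⟨y, hy⟩ := (hF.tendsto_atTop.eventually (lt_mem_nhds hv)).exists
  exact le_csInf ⟨y, hy.le⟩ fun z hz => quantile_le hF hu (huv.trans hz)

/-- A tail that satisfies a second-order condition satisfies the first-order one. -/
lemma tendsto_mul_rpow_of_secondOrder {T : ℝ → ℝ} {c α b β : ℝ} (hc : 0 < c) (hβ : 0 < β)
    (h : Tendsto (fun x : ℝ => (T x / (c * x ^ (-α)) - 1) * x ^ β) atTop (𝓝 b)) :
    Tendsto (fun x : ℝ => T x * x ^ α) atTop (𝓝 c) := by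
  have h1 := ((h.mul (tendsto_rpow_neg_atTop hβ)).add_const 1).const_mul c
  rw [mul_zero, zero_add, mul_one] at h1
  refine h1.congr' ?_
  filter_upwards [eventually_gt_atTop 0] with x hx
  have hxβ := Real.rpow_pos_of_pos hx β
  have hxα := Real.rpow_pos_of_pos hx α
  rw [Real.rpow_neg hx.le, Real.rpow_neg hx.le]
  field_simp
  ring

lemma tendsto_const_mul_rpow_neg {K a : ℝ} (hK : 0 < K) (ha : 0 < a) :
    Tendsto (fun u : ℝ => K * u ^ (-a)) (𝓝[>] 0) atTop :=
  (tendsto_rpow_neg_nhdsGT_zero (neg_lt_zero.2 ha)).const_mul_atTop hK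

/-- A regularly varying tail evaluated at the scale of its own quantile. -/
lemma tendsto_tail_div {T : ℝ → ℝ} {c α K : ℝ} (hα : 0 < α) (hK : 0 < K)
    (h : Tendsto (fun x : ℝ => T x * x ^ α) atTop (𝓝 c)) :
    Tendsto (fun u : ℝ => T (K * u ^ (-α⁻¹)) / u) (𝓝[>] 0) (𝓝 (c / K ^ α)) := by
  have h1 := (h.comp (tendsto_const_mul_rpow_neg hK (inv_pos.2 hα))).div_const (K ^ α)
  refine h1.congr' ?_
  filter_upwards [self_mem_nhdsWithin] with u hu
  have hu : 0 < u := hu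
  have hKα := Real.rpow_pos_of_pos hK α
  simp only [Function.comp]
  rw [Real.mul_rpow hK.le (Real.rpow_nonneg hu.le _), ← Real.rpow_mul hu.le,
    neg_mul, inv_mul_cancel₀ hα.ne', Real.rpow_neg_one]
  field_simp

/-- First-order asymptotics of the quantile function at `0`. -/
lemma tendsto_quantile_mul_rpow {F : ℝ → ℝ} (hF : IsDistributionFunction F) {c α : ℝ}
    (hc : 0 < c) (hα : 0 < α) (h : Tendsto (fun x : ℝ => F (-x) * x ^ α) atTop (𝓝 c)) :
    Tendsto (fun u : ℝ => quantile F u * u ^ α⁻¹) (𝓝[>] 0) (𝓝 (-c ^ α⁻¹)) := by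
  have hD : 0 < c ^ α⁻¹ := Real.rpow_pos_of_pos hc _
  have hDα : (c ^ α⁻¹) ^ α = c := Real.rpow_inv_rpow hc.le hα.ne'
  have small : ∀ᶠ u : ℝ in 𝓝[>] 0, 0 < u ∧ u < 1 :=
    Ioo_mem_nhdsGT one_pos
  rw [tendsto_order]
  constructor
  · intro r hr
    obtain ⟨K, hK1, hK2⟩ := exists_between (lt_neg.2 hr)
    have hK0 : 0 < K := hD.trans hK1
    have hlt : c / K ^ α < 1 := by
      rw [div_lt_one (Real.rpow_pos_of_pos hK0 _)]
      calc c = (c ^ α⁻¹) ^ α := hDα.symm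
        _ < K ^ α := Real.rpow_lt_rpow hD.le hK1 hα
    filter_upwards [(tendsto_tail_div hα hK0 h).eventually (gt_mem_nhds hlt), small]
      with u hu ⟨hu0, hu1⟩
    have h1 := le_quantile_s4 hF hu1 ((div_lt_one hu0).1 hu)
    have hp := Real.rpow_pos_of_pos hu0 α⁻¹
    have h2 := mul_le_mul_of_nonneg_right h1 hp.le
    rw [Real.rpow_neg hu0.le, neg_mul, inv_mul_cancel_right₀ hp.ne'] at h2
    linarith
  · intro r hr
    obtain ⟨K, hK2, hK1⟩ := exists_between (max_lt (neg_lt.2 hr) hD)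
    have hK0 : 0 < K := (le_max_right _ _).trans_lt hK2
    have hlt : 1 < c / K ^ α := by
      rw [one_lt_div (Real.rpow_pos_of_pos hK0 _)]
      calc K ^ α < (c ^ α⁻¹) ^ α := Real.rpow_lt_rpow hK0.le hK1 hα
        _ = c := hDα
    filter_upwards [(tendsto_tail_div hα hK0 h).eventually (lt_mem_nhds hlt), small]
      with u hu ⟨hu0, hu1⟩
    have h1 := quantile_le hF hu0 ((one_lt_div hu0).1 hu).le
    have hp := Real.rpow_pos_of_pos hu0 α⁻¹
    have h2 := mul_le_mul_of_nonneg_right h1 hp.le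
    rw [Real.rpow_neg hu0.le, neg_mul, inv_mul_cancel_right₀ hp.ne'] at h2
    linarith [(le_max_left _ _).trans_lt hK2]

lemma exists_neg_le_quantile {F : ℝ → ℝ} (hF : IsDistributionFunction F) {c α : ℝ}
    (hc : 0 < c) (hα : 0 < α) (h : Tendsto (fun x : ℝ => F (-x) * x ^ α) atTop (𝓝 c)) :
    ∃ K : ℝ, 0 < K ∧ ∀ u ∈ Ioo (0 : ℝ) 1, -(K * u ^ (-α⁻¹)) ≤ quantile F u := by
  have hev := (tendsto_quantile_mul_rpow hF hc hα h).eventually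
    (lt_mem_nhds (sub_one_lt (-c ^ α⁻¹)))
  obtain ⟨δ, hδ, hev⟩ := mem_nhdsGT_iff_exists_Ioo_subset.1 hev
  have hδ : 0 < δ := hδ
  have hD : 0 < c ^ α⁻¹ := Real.rpow_pos_of_pos hc _
  set η := min δ 1 / 2
  have hη : 0 < η := by positivity
  have hηδ : η < δ := by have := min_le_left δ 1; simp only [η]; linarith [lt_min hδ one_pos]
  refine ⟨c ^ α⁻¹ + 1 + |quantile F η|, by positivity, fun u hu => ?_⟩
  have hp := Real.rpow_pos_of_pos hu.1 α⁻¹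
  have hp1 : 1 ≤ u ^ (-α⁻¹) :=
    Real.one_le_rpow_of_pos_of_le_one_of_nonpos hu.1 hu.2.le (by simpa using hα.le)
  by_cases huδ : u < δ
  · have h1 : -c ^ α⁻¹ - 1 < quantile F u * u ^ α⁻¹ := hev ⟨hu.1, huδ⟩
    have h2 := mul_le_mul_of_nonneg_right h1.le (Real.rpow_nonneg hu.1.le (-α⁻¹))
    rw [mul_assoc, ← Real.rpow_add hu.1, add_neg_cancel, Real.rpow_zero, mul_one] at h2
    nlinarith [abs_nonneg (quantile F η)]
  · have h1 := quantile_mono hF hη hu.2 (hηδ.le.trans (not_lt.1 huδ))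
    nlinarith [neg_abs_le (quantile F η), abs_nonneg (quantile F η)]

lemma exists_quantile_le {F : ℝ → ℝ} (hF : IsDistributionFunction F) {c α : ℝ}
    (hc : 0 < c) (hα : 0 < α) (h : Tendsto (fun x : ℝ => (1 - F x) * x ^ α) atTop (𝓝 c)) :
    ∃ K : ℝ, 0 < K ∧ ∀ u ∈ Ioo (0 : ℝ) 1, quantile F u ≤ K * (1 - u) ^ (-α⁻¹) := by
  have hD : 0 < c ^ α⁻¹ := Real.rpow_pos_of_pos hc _
  have hK0 : 0 < c ^ α⁻¹ + 1 := by positivity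
  have hlt : c / (c ^ α⁻¹ + 1) ^ α < 1 := by
    rw [div_lt_one (Real.rpow_pos_of_pos hK0 _)]
    calc c = (c ^ α⁻¹) ^ α := (Real.rpow_inv_rpow hc.le hα.ne').symm
      _ < _ := Real.rpow_lt_rpow hD.le (lt_add_one _) hα
  have hev := (tendsto_tail_div (T := fun x => 1 - F x) hα hK0 h).eventually (gt_mem_nhds hlt)
  obtain ⟨δ, hδ, hev⟩ := mem_nhdsGT_iff_exists_Ioo_subset.1 hev
  have hδ : 0 < δ := hδ
  set η := min δ 1 / 2
  have hη : 0 < η := by positivity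
  have hηδ : η < δ := by have := min_le_left δ 1; simp only [η]; linarith [lt_min hδ one_pos]
  refine ⟨c ^ α⁻¹ + 1 + |quantile F (1 - η)|, by positivity, fun u hu => ?_⟩
  have hv : 0 < 1 - u := sub_pos.2 hu.2
  have hp1 : 1 ≤ (1 - u) ^ (-α⁻¹) :=
    Real.one_le_rpow_of_pos_of_le_one_of_nonpos hv (by linarith [hu.1]) (by simpa using hα.le)
  by_cases huδ : 1 - u < δ
  · have h1 : (1 - F ((c ^ α⁻¹ + 1) * (1 - u) ^ (-α⁻¹))) / (1 - u) < 1 := hev ⟨hv, huδ⟩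
    rw [div_lt_one hv] at h1
    have h2 := quantile_le hF hu.1 (x := (c ^ α⁻¹ + 1) * (1 - u) ^ (-α⁻¹)) (by linarith)
    nlinarith [abs_nonneg (quantile F (1 - η))]
  · have h1 := quantile_mono hF hu.1 (v := 1 - η) (by linarith) (by linarith)
    nlinarith [le_abs_self (quantile F (1 - η)), abs_nonneg (quantile F (1 - η))]

section Covariance

/-- The indicator of `x < u`, as a real number. -/
noncomputable def ltIndicator (x u : ℝ) : ℝ := (Ioi x).indicator 1 u

lemma ltIndicator_eq (x u : ℝ) : ltIndicator x u = (Iio u).indicator 1 x := by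
  by_cases h : x < u <;> simp [ltIndicator, h]

lemma measurable_ltIndicator : Measurable (fun p : ℝ × ℝ => ltIndicator p.1 p.2) := by
  have : (fun p : ℝ × ℝ => ltIndicator p.1 p.2) = {p : ℝ × ℝ | p.1 < p.2}.indicator 1 := by
    ext p
    by_cases h : p.1 < p.2 <;> simp [ltIndicator, h]
  rw [this]
  exact measurable_one.indicator (measurableSet_lt measurable_fst measurable_snd)

lemma norm_ltIndicator_le (x u : ℝ) : ‖ltIndicator x u‖ ≤ 1 := by
  by_cases h : x < u <;> simp [ltIndicator, h]

lemma integral_ltIndicator {u : ℝ} (h0 : 0 < u) (h1 : u < 1) :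
    ∫ x in Ioo (0 : ℝ) 1, ltIndicator x u = u := by
  simp_rw [ltIndicator_eq]
  rw [integral_indicator_one measurableSet_Iio, Measure.real, Measure.restrict_apply
    measurableSet_Iio]
  have : Iio u ∩ Ioo (0 : ℝ) 1 = Ioo 0 u := by
    ext x; simp only [mem_inter_iff, mem_Iio, mem_Ioo]; grind
  rw [this, Real.volume_Ioo, sub_zero, ENNReal.toReal_ofReal h0.le]

lemma ltIndicator_mul (x u v : ℝ) :
    ltIndicator x u * ltIndicator x v = ltIndicator x (min u v) := by
  by_cases h : x < u <;> by_cases h' : x < v <;> simp [ltIndicator, h, h']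

lemma integrable_clamp_pow (G : StieltjesFunction ℝ) {s T : ℝ} (hsT : s ≤ T) (ℓ : Measure ℝ)
    [IsFiniteMeasure ℓ] (n : ℕ) : Integrable (fun x => G (max s (min x T)) ^ n) ℓ := by
  have hmono : Monotone fun x => G (max s (min x T)) := fun x y h => G.mono (by gcongr)
  refine .of_bound (hmono.measurable.pow_const n).aestronglyMeasurable
    (max |G s| |G T| ^ n) (.of_forall fun x => ?_)
  rw [norm_pow]
  exact pow_le_pow_left₀ (norm_nonneg _) (abs_le_max_abs_abs (G.mono (le_max_left _ _))
    (G.mono (max_le hsT (min_le_right _ _)))) n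

/-- The double integral of the Brownian-bridge covariance against a Stieltjes measure is the
variance of the clamped Stieltjes function under the uniform distribution. -/
lemma integral_integral_min_sub_mul_s4 (G : StieltjesFunction ℝ) {s T : ℝ} (hs : 0 < s) (hT : T < 1)
    (hsT : s ≤ T) :
    ∫ u in Ioc s T, ∫ v in Ioc s T, (min u v - u * v) ∂G.measure ∂G.measure =
      (∫ x in Ioo (0 : ℝ) 1, G (max s (min x T)) ^ 2) -
        (∫ x in Ioo (0 : ℝ) 1, G (max s (min x T))) ^ 2 := by
  set μ := G.measure.restrict (Ioc s T) with hμ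
  set ℓ := (volume : Measure ℝ).restrict (Ioo 0 1) with hℓ
  have : IsFiniteMeasure μ := ⟨by simp [hμ]⟩
  have : IsProbabilityMeasure ℓ := ⟨by simp [hℓ]⟩
  have hmem : ∀ᵐ u ∂μ, u ∈ Ioc s T := ae_restrict_mem measurableSet_Ioc
  set W : ℝ → ℝ := fun x => G (max s (min x T)) with hW
  have hWi : Integrable W ℓ := by simpa using integrable_clamp_pow G hsT ℓ 1
  have hW2i : Integrable (fun x => W x ^ 2) ℓ := integrable_clamp_pow G hsT ℓ 2
  have hinner : ∀ x, ∫ u, ltIndicator x u ∂μ = G T - W x := by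
    intro x
    simp only [ltIndicator]
    rw [integral_indicator_one measurableSet_Ioi, Measure.real, hμ,
      Measure.restrict_apply measurableSet_Ioi]
    have : Ioi x ∩ Ioc s T = Ioc (max s (min x T)) T := by
      ext y; simp only [mem_inter_iff, mem_Ioi, mem_Ioc]; grind
    rw [this, StieltjesFunction.measure_Ioc, ENNReal.toReal_ofReal]
    exact sub_nonneg.2 (G.mono (max_le hsT (min_le_right _ _)))
  have hbound : ∀ (q : (ℝ × ℝ) × ℝ),
      ‖ltIndicator q.2 q.1.1 * ltIndicator q.2 q.1.2‖ ≤ 1 := fun q => by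
    rw [norm_mul]
    exact mul_le_one₀ (norm_ltIndicator_le _ _) (norm_nonneg _) (norm_ltIndicator_le _ _)
  have hmean : ∫ u, u ∂μ = ∫ x, (G T - W x) ∂ℓ := by
    calc ∫ u, u ∂μ = ∫ u, ∫ x, ltIndicator x u ∂ℓ ∂μ := by
          refine integral_congr_ae ?_
          filter_upwards [hmem] with u hu
          exact (integral_ltIndicator (hs.trans hu.1) (hu.2.trans_lt hT)).symm
      _ = ∫ x, ∫ u, ltIndicator x u ∂μ ∂ℓ := by
          refine integral_integral_swap (.of_bound (C := 1) ?_
            (.of_forall fun p => norm_ltIndicator_le _ _))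
          exact (measurable_ltIndicator.comp measurable_swap).aestronglyMeasurable
      _ = _ := by simp_rw [hinner]
  have hmin : ∫ p : ℝ × ℝ, min p.1 p.2 ∂(μ.prod μ) = ∫ x, (G T - W x) ^ 2 ∂ℓ := by
    calc ∫ p : ℝ × ℝ, min p.1 p.2 ∂(μ.prod μ)
        = ∫ p : ℝ × ℝ, ∫ x, ltIndicator x p.1 * ltIndicator x p.2 ∂ℓ ∂(μ.prod μ) := by
          refine integral_congr_ae ?_
          filter_upwards [Measure.quasiMeasurePreserving_fst.ae hmem,
            Measure.quasiMeasurePreserving_snd.ae hmem] with p hp1 hp2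
          simp_rw [ltIndicator_mul]
          exact (integral_ltIndicator (lt_min (hs.trans hp1.1) (hs.trans hp2.1))
            ((min_le_left _ _).trans_lt (hp1.2.trans_lt hT))).symm
      _ = ∫ x, ∫ p : ℝ × ℝ, ltIndicator x p.1 * ltIndicator x p.2 ∂(μ.prod μ) ∂ℓ := by
          refine integral_integral_swap (.of_bound (C := 1) ?_ (.of_forall fun q => hbound q))
          exact Measurable.aestronglyMeasurable
            ((measurable_ltIndicator.comp
              (measurable_snd.prodMk (measurable_fst.comp measurable_fst))).mul
            (measurable_ltIndicator.comp
              (measurable_snd.prodMk (measurable_snd.comp measurable_fst))))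
      _ = _ := by
          refine integral_congr_ae (.of_forall fun x => ?_)
          simp only
          rw [integral_prod_mul (fun u => ltIndicator x u) (fun u => ltIndicator x u), hinner, sq]
  have hbd : ∀ᵐ u ∂μ, ‖u‖ ≤ 1 := by
    filter_upwards [hmem] with u hu
    rw [Real.norm_of_nonneg (hs.le.trans hu.1.le)]
    exact hu.2.trans hT.le
  have hfst := Measure.quasiMeasurePreserving_fst (μ := μ) (ν := μ) |>.ae hbd
  have hsnd := Measure.quasiMeasurePreserving_snd (μ := μ) (ν := μ) |>.ae hbd
  have hi1 : Integrable (fun p : ℝ × ℝ => min p.1 p.2) (μ.prod μ) := by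
    refine .of_bound (C := 1) (by fun_prop) ?_
    filter_upwards [hfst, hsnd] with p h1 h2
    rcases min_choice p.1 p.2 with h | h <;> rwa [h]
  have hi2 : Integrable (fun p : ℝ × ℝ => p.1 * p.2) (μ.prod μ) := by
    refine .of_bound (C := 1) (by fun_prop) ?_
    filter_upwards [hfst, hsnd] with p h1 h2
    rw [norm_mul]
    exact mul_le_one₀ h1 (norm_nonneg _) h2
  have hprod : ∫ p : ℝ × ℝ, p.1 * p.2 ∂(μ.prod μ) = (∫ u, u ∂μ) * ∫ u, u ∂μ :=
    integral_prod_mul (fun u : ℝ => u) (fun u : ℝ => u)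
  rw [integral_integral (f := fun u v : ℝ => min u v - u * v) (hi1.sub hi2),
    integral_sub hi1 hi2, hmin, hprod, hmean]
  have hexp : ∫ x, (G T - W x) ∂ℓ = G T - ∫ x, W x ∂ℓ := by
    rw [integral_sub (integrable_const _) hWi]; simp
  have hexp2 : ∫ x, (G T - W x) ^ 2 ∂ℓ =
      G T ^ 2 - 2 * G T * ∫ x, W x ∂ℓ + ∫ x, W x ^ 2 ∂ℓ := by
    have : ∀ x, (G T - W x) ^ 2 = (G T ^ 2 - 2 * G T * W x) + W x ^ 2 := fun x => by ring
    have hlin : Integrable (fun x => G T ^ 2 - 2 * G T * W x) ℓ :=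
      (integrable_const _).sub (hWi.const_mul _)
    simp_rw [this]
    rw [integral_add hlin hW2i,
      integral_sub (integrable_const _) (hWi.const_mul _), integral_const_mul]
    simp
  rw [hexp, hexp2]
  ring

end Covariance

/-- The right-continuous quantile function, clamped to `[s, 1 - t]`. -/
noncomputable def winsorized (F : ℝ → ℝ) (s t x : ℝ) : ℝ :=
  Function.rightLim (clampedQuantile F s t) (max s (min x (1 - t)))

lemma clampedQuantile_mono {F : ℝ → ℝ} (hF : IsDistributionFunction F) {s t : ℝ}
    (hs : s ∈ Ioo (0 : ℝ) (1 / 2)) (ht : t ∈ Ioo (0 : ℝ) (1 / 2)) :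
    Monotone (clampedQuantile F s t) := fun x y h => by
  have h1 := hs.1; have h2 := hs.2; have h3 := ht.1; have h4 := ht.2
  refine quantile_mono hF (lt_max_of_lt_left h1) (max_lt (by linarith) ?_) (by gcongr)
  exact (min_le_right _ _).trans_lt (by linarith)

lemma winsorized_mono {F : ℝ → ℝ} (hF : IsDistributionFunction F) {s t : ℝ}
    (hs : s ∈ Ioo (0 : ℝ) (1 / 2)) (ht : t ∈ Ioo (0 : ℝ) (1 / 2)) :
    Monotone (winsorized F s t) := fun x y h =>
  (clampedQuantile_mono hF hs ht).rightLim (by gcongr)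

lemma integrable_winsorized_pow {F : ℝ → ℝ} (hF : IsDistributionFunction F) {s t : ℝ}
    (hs : s ∈ Ioo (0 : ℝ) (1 / 2)) (ht : t ∈ Ioo (0 : ℝ) (1 / 2)) (ℓ : Measure ℝ)
    [IsFiniteMeasure ℓ] (n : ℕ) : Integrable (fun x => winsorized F s t x ^ n) ℓ :=
  integrable_clamp_pow (clampedQuantile_mono hF hs ht).stieltjesFunction
    (by linarith [hs.2, ht.2]) ℓ n

lemma sigmaSq_eq {F : ℝ → ℝ} (hF : IsDistributionFunction F) {s t : ℝ}
    (hs : s ∈ Ioo (0 : ℝ) (1 / 2)) (ht : t ∈ Ioo (0 : ℝ) (1 / 2)) :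
    sigmaSq F s t = (∫ x in Ioo (0 : ℝ) 1, winsorized F s t x ^ 2) -
      (∫ x in Ioo (0 : ℝ) 1, winsorized F s t x) ^ 2 := by
  have hg := clampedQuantile_mono hF hs ht
  rw [sigmaSq, lsMeasure, dif_pos hg]
  exact integral_integral_min_sub_mul_s4 hg.stieltjesFunction hs.1 (by linarith [ht.1])
    (by linarith [hs.2, ht.2])

lemma exists_abs_winsorized_le {F : ℝ → ℝ} (hF : IsDistributionFunction F) {c α c' α' : ℝ}
    (hc : 0 < c) (hα : 0 < α) (hL : Tendsto (fun x : ℝ => F (-x) * x ^ α) atTop (𝓝 c))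
    (hc' : 0 < c') (hα' : 0 < α')
    (hR : Tendsto (fun x : ℝ => (1 - F x) * x ^ α') atTop (𝓝 c')) :
    ∃ K : ℝ, 0 < K ∧ ∀ s ∈ Ioo (0 : ℝ) (1 / 2), ∀ t ∈ Ioo (0 : ℝ) (1 / 2),
      ∀ x ∈ Ioo (0 : ℝ) 1, |winsorized F s t x| ≤ K * (x ^ (-α⁻¹) + (1 - x) ^ (-α'⁻¹)) := by
  obtain ⟨K₁, hK₁, h₁⟩ := exists_neg_le_quantile hF hc hα hL
  obtain ⟨K₂, hK₂, h₂⟩ := exists_quantile_le hF hc' hα' hR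
  have e₁ : (0 : ℝ) < (1 / 2) ^ (-α⁻¹) := by positivity
  have e₂ : (0 : ℝ) < (1 / 4) ^ (-α'⁻¹) := by positivity
  refine ⟨K₁ * (1 / 2) ^ (-α⁻¹) + K₂ * (1 / 4) ^ (-α'⁻¹), by positivity,
    fun s ⟨hs0, hs1⟩ t ⟨ht0, ht1⟩ x ⟨hx0, hx1⟩ => ?_⟩
  have hg := clampedQuantile_mono hF ⟨hs0, hs1⟩ ⟨ht0, ht1⟩
  have hx1' : 0 < 1 - x := sub_pos.2 hx1
  have p₁ : 0 < x ^ (-α⁻¹) := Real.rpow_pos_of_pos hx0 _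
  have p₂ : 0 < (1 - x) ^ (-α'⁻¹) := Real.rpow_pos_of_pos hx1' _
  set z := max s (min x (1 - t)) with hz
  have hz1 : z < 1 := max_lt (by linarith) ((min_le_left _ _).trans_lt hx1)
  have lower : -(K₁ * ((1 / 2) ^ (-α⁻¹) * x ^ (-α⁻¹))) ≤ winsorized F s t x := by
    have hm0 : 0 < min x (1 / 2) := lt_min hx0 (by norm_num)
    calc -(K₁ * ((1 / 2) ^ (-α⁻¹) * x ^ (-α⁻¹))) = -(K₁ * (1 / 2 * x) ^ (-α⁻¹)) := by
          rw [Real.mul_rpow (by norm_num) hx0.le]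
      _ ≤ -(K₁ * (min x (1 / 2)) ^ (-α⁻¹)) := by
          have : 1 / 2 * x ≤ min x (1 / 2) := le_min (by linarith) (by linarith)
          have := Real.rpow_le_rpow_of_nonpos (by positivity) this
            (show -α⁻¹ ≤ 0 by simpa using hα.le)
          gcongr
      _ ≤ quantile F (min x (1 / 2)) :=
          h₁ _ ⟨hm0, (min_le_left _ _).trans_lt hx1⟩
      _ ≤ clampedQuantile F s t z := by
          refine quantile_mono hF hm0 (max_lt (by linarith) ?_) ?_
          · exact (min_le_right _ _).trans_lt (by linarith)
          · refine le_max_of_le_right (le_min ?_ ?_)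
            · exact le_max_of_le_right (min_le_min_left _ (by linarith))
            · exact (min_le_right _ _).trans (by linarith)
      _ ≤ winsorized F s t x := hg.le_rightLim le_rfl
  have upper : winsorized F s t x ≤ K₂ * ((1 / 4) ^ (-α'⁻¹) * (1 - x) ^ (-α'⁻¹)) := by
    have hm1 : max x (1 / 2) < 1 := max_lt hx1 (by norm_num)
    have hm2 : 1 / 2 ≤ max x (1 / 2) := le_max_right _ _
    calc winsorized F s t x ≤ clampedQuantile F s t ((1 + z) / 2) :=
          hg.rightLim_le (by linarith)
      _ ≤ quantile F ((1 + max x (1 / 2)) / 2) := by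
          refine quantile_mono hF (lt_max_of_lt_left hs0) (by linarith) (max_le (by linarith) ?_)
          refine (min_le_left _ _).trans ?_
          have : z ≤ max x (1 / 2) :=
            max_le (by linarith) ((min_le_left _ _).trans (le_max_left _ _))
          linarith
      _ ≤ K₂ * (1 - (1 + max x (1 / 2)) / 2) ^ (-α'⁻¹) := h₂ _ ⟨by linarith, by linarith⟩
      _ ≤ K₂ * (1 / 4 * (1 - x)) ^ (-α'⁻¹) := by
          have hle : 1 / 4 * (1 - x) ≤ 1 - (1 + max x (1 / 2)) / 2 := by
            rcases max_choice x (1 / 2) with h | h <;> rw [h] <;> linarith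
          have := Real.rpow_le_rpow_of_nonpos (by positivity) hle
            (show -α'⁻¹ ≤ 0 by simpa using hα'.le)
          gcongr
      _ = K₂ * ((1 / 4) ^ (-α'⁻¹) * (1 - x) ^ (-α'⁻¹)) := by
          rw [Real.mul_rpow (by norm_num) hx1'.le]
  have q₁ : 0 < K₁ * (1 / 2) ^ (-α⁻¹) := by positivity
  have q₂ : 0 < K₂ * (1 / 4) ^ (-α'⁻¹) := by positivity
  rw [abs_le]
  constructor <;>
  nlinarith [mul_pos q₁ p₁, mul_pos q₁ p₂, mul_pos q₂ p₁, mul_pos q₂ p₂]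

/-- Local behaviour of the right-continuous clamped quantile at points tending to `0`. -/
lemma tendsto_rightLim_clampedQuantile_mul_rpow {F : ℝ → ℝ} (hF : IsDistributionFunction F)
    {c α : ℝ} (hc : 0 < c) (hα : 0 < α)
    (hL : Tendsto (fun x : ℝ => F (-x) * x ^ α) atTop (𝓝 c)) {s t z : ℕ → ℝ}
    (hs : ∀ᶠ n in atTop, s n ∈ Ioo (0 : ℝ) (1 / 2))
    (ht : ∀ᶠ n in atTop, t n ∈ Ioo (0 : ℝ) (1 / 2))
    (hz : Tendsto z atTop (𝓝[>] 0)) (hsz : ∀ n, s n ≤ z n) :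
    Tendsto (fun n => Function.rightLim (clampedQuantile F (s n) (t n)) (z n) * z n ^ α⁻¹) atTop
      (𝓝 (-c ^ α⁻¹)) := by
  have hQ := tendsto_quantile_mul_rpow hF hc hα hL
  have hz' := tendsto_nhdsWithin_iff.1 hz
  have hz0 : ∀ᶠ n in atTop, 0 < z n := hz'.2
  have hz1 : ∀ᶠ n in atTop, z n < 1 / 4 := hz'.1.eventually (gt_mem_nhds (by norm_num))
  have hw : Tendsto (fun n => z n * (1 + z n)) atTop (𝓝[>] 0) := by
    refine tendsto_nhdsWithin_iff.2 ⟨?_, ?_⟩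
    · simpa using hz'.1.mul (hz'.1.const_add 1)
    · filter_upwards [hz0] with n hn
      exact mul_pos hn (by linarith)
  have hup : Tendsto (fun n => quantile F (z n * (1 + z n)) * z n ^ α⁻¹) atTop
      (𝓝 (-c ^ α⁻¹)) := by
    have h1 : Tendsto (fun n => (1 + z n) ^ (-α⁻¹)) atTop (𝓝 1) := by
      have h := (hz'.1.const_add 1).rpow_const (p := -α⁻¹) (Or.inl (by norm_num))
      simpa using h
    have h2 := (hQ.comp hw).mul h1
    rw [mul_one] at h2
    refine h2.congr' ?_
    filter_upwards [hz0] with n hn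
    have h1n : 0 < 1 + z n := by linarith
    have := Real.rpow_pos_of_pos h1n α⁻¹
    simp only [Function.comp]
    rw [Real.mul_rpow hn.le h1n.le, Real.rpow_neg h1n.le]
    field_simp
  refine tendsto_of_tendsto_of_tendsto_of_le_of_le' (hQ.comp hz) hup ?_ ?_
  · filter_upwards [hs, ht, hz0, hz1] with n hsn htn h0 h1
    refine mul_le_mul_of_nonneg_right ?_ (Real.rpow_nonneg h0.le _)
    have : quantile F (z n) = clampedQuantile F (s n) (t n) (z n) := by
      rw [clampedQuantile, min_eq_left (by linarith [htn.2]), max_eq_right (hsz n)]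
    rw [this]
    exact (clampedQuantile_mono hF hsn htn).le_rightLim le_rfl
  · filter_upwards [hs, ht, hz0, hz1] with n hsn htn h0 h1
    refine mul_le_mul_of_nonneg_right ?_ (Real.rpow_nonneg h0.le _)
    have hlt : z n < z n * (1 + z n) := by nlinarith
    have : quantile F (z n * (1 + z n)) = clampedQuantile F (s n) (t n) (z n * (1 + z n)) := by
      rw [clampedQuantile, min_eq_left (by nlinarith [htn.2]),
        max_eq_right ((hsz n).trans hlt.le)]
    rw [this]
    exact (clampedQuantile_mono hF hsn htn).rightLim_le hlt

lemma winsorized_mul {F : ℝ → ℝ} {s t y : ℝ} (hs : 0 < s) (hy : s * y ≤ 1 - t) :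
    winsorized F s t (s * y) = Function.rightLim (clampedQuantile F s t) (s * max 1 y) := by
  rw [winsorized, min_eq_left hy, mul_max_of_nonneg _ _ hs.le, mul_one]

lemma integrableOn_max_one_rpow {p : ℝ} (hp : p < -1) :
    IntegrableOn (fun y : ℝ => max 1 y ^ p) (Ioi 0) := by
  rw [← Ioc_union_Ioi_eq_Ioi zero_le_one]
  refine IntegrableOn.union ?_ ?_
  · refine (integrableOn_const (C := (1 : ℝ)) (by simp)).congr_fun (fun y hy => ?_) measurableSet_Ioc
    simp [max_eq_left hy.2]
  · refine (integrableOn_Ioi_rpow_of_lt hp one_pos).congr_fun (fun y hy => ?_) measurableSet_Ioi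
    simp [max_eq_right (le_of_lt (mem_Ioi.1 hy))]

lemma integral_max_one_rpow_pos {p : ℝ} (hp : p < -1) :
    0 < ∫ y in Ioi (0 : ℝ), max 1 y ^ p := by
  have h : ∫ y in Ioc (0 : ℝ) 1, max 1 y ^ p ≤ ∫ y in Ioi (0 : ℝ), max 1 y ^ p :=
    setIntegral_mono_set (integrableOn_max_one_rpow hp)
      (.of_forall fun y => Real.rpow_nonneg (zero_le_one.trans (le_max_left _ _)) _)
      (.of_forall fun y hy => hy.1)
  have h1 : ∫ y in Ioc (0 : ℝ) 1, max 1 y ^ p = 1 := by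
    rw [setIntegral_congr_fun (g := fun _ => (1 : ℝ)) measurableSet_Ioc
      (fun y hy => by simp [max_eq_left hy.2])]
    simp
  linarith

/-- The contribution of the left tail to the second moment of the winsorized quantile. -/
lemma tendsto_rpow_mul_integral_winsorized_sq {F : ℝ → ℝ} (hF : IsDistributionFunction F)
    {c α c' α' : ℝ} (hc : 0 < c) (hα : 0 < α) (hα2 : α < 2)
    (hL : Tendsto (fun x : ℝ => F (-x) * x ^ α) atTop (𝓝 c)) (hc' : 0 < c') (hα' : 0 < α')
    (hR : Tendsto (fun x : ℝ => (1 - F x) * x ^ α') atTop (𝓝 c')) {s t : ℕ → ℝ}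
    (hs : Tendsto s atTop (𝓝[>] 0)) (ht : Tendsto t atTop (𝓝[>] 0)) :
    Tendsto (fun n => s n ^ (2 * α⁻¹ - 1) * ∫ x in Ioc (0 : ℝ) (1 / 2),
        winsorized F (s n) (t n) x ^ 2) atTop
      (𝓝 (∫ y in Ioi (0 : ℝ), (c ^ α⁻¹) ^ 2 * max 1 y ^ (-(2 * α⁻¹)))) := by
  obtain ⟨K, hK, hbound⟩ := exists_abs_winsorized_le hF hc hα hL hc' hα' hR
  have hsI : ∀ᶠ n in atTop, s n ∈ Ioo (0 : ℝ) (1 / 2) :=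
    hs.eventually (Ioo_mem_nhdsGT (by norm_num))
  have htI : ∀ᶠ n in atTop, t n ∈ Ioo (0 : ℝ) (1 / 2) :=
    ht.eventually (Ioo_mem_nhdsGT (by norm_num))
  have ha : 0 < α⁻¹ := inv_pos.2 hα
  have hb : 0 < α'⁻¹ := inv_pos.2 hα'
  have ha2 : -(2 * α⁻¹) < -1 := by
    have : 2⁻¹ < α⁻¹ := (inv_lt_inv₀ two_pos hα).2 hα2
    linarith
  have hmax : ∀ y : ℝ, 0 < max 1 y := fun y => one_pos.trans_le (le_max_left _ _)
  have hsq : ∀ {z : ℝ}, 0 < z → ∀ r : ℝ, (z ^ r) ^ 2 = z ^ (2 * r) := fun hz r => by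
    rw [← Real.rpow_natCast, ← Real.rpow_mul hz.le]; push_cast; ring_nf
  set f : ℕ → ℝ → ℝ := fun n => (Ioc 0 (1 / (2 * s n))).indicator
    fun y => s n ^ (2 * α⁻¹) * winsorized F (s n) (t n) (s n * y) ^ 2 with hf
  have key : Tendsto (fun n => ∫ y in Ioi (0 : ℝ), f n y) atTop
      (𝓝 (∫ y in Ioi (0 : ℝ), (c ^ α⁻¹) ^ 2 * max 1 y ^ (-(2 * α⁻¹)))) := by
    refine tendsto_integral_filter_of_dominated_convergence
      (fun y => (K * (1 + (1 / 2) ^ (-α'⁻¹))) ^ 2 * max 1 y ^ (-(2 * α⁻¹))) ?_ ?_ ?_ ?_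
    · filter_upwards [hsI, htI] with n hsn htn
      refine (Measurable.indicator ?_ measurableSet_Ioc).aestronglyMeasurable
      exact (((winsorized_mono hF hsn htn).measurable.comp (measurable_const_mul _)).pow_const
        2).const_mul _
    · filter_upwards [hsI, htI] with n hsn htn
      filter_upwards [ae_restrict_mem measurableSet_Ioi] with y hy
      have hp : 0 < max 1 y ^ (-(2 * α⁻¹)) := Real.rpow_pos_of_pos (hmax y) _
      by_cases hyn : y ∈ Ioc 0 (1 / (2 * s n))
      swap
      · simp only [hf, indicator_of_notMem hyn, norm_zero]
        positivity
      have hs0 := hsn.1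
      have hsy : s n * y ≤ 1 / 2 := by
        have := hyn.2
        rw [le_div_iff₀ (by positivity)] at this
        linarith
      set z := s n * max 1 y with hz
      have hz0 : 0 < z := mul_pos hs0 (hmax y)
      have hz2 : z ≤ 1 / 2 := by
        rw [hz, mul_max_of_nonneg _ _ hs0.le, mul_one]
        exact max_le hsn.2.le hsy
      have hWz : winsorized F (s n) (t n) (s n * y) = winsorized F (s n) (t n) z := by
        rw [hz, winsorized_mul hs0 (by linarith [htn.2]),
          winsorized_mul hs0 (by linarith [htn.2]), max_eq_right (le_max_left 1 y)]
      have hW : |winsorized F (s n) (t n) z| ≤ K * (1 + (1 / 2) ^ (-α'⁻¹)) * z ^ (-α⁻¹) := by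
        refine (hbound _ hsn _ htn z ⟨hz0, by linarith⟩).trans ?_
        have h1 : (1 - z) ^ (-α'⁻¹) ≤ (1 / 2) ^ (-α'⁻¹) :=
          Real.rpow_le_rpow_of_nonpos (by norm_num) (by linarith) (by linarith)
        have h2 : 1 ≤ z ^ (-α⁻¹) :=
          Real.one_le_rpow_of_pos_of_le_one_of_nonpos hz0 (by linarith) (by linarith)
        have h3 : (0 : ℝ) < (1 / 2) ^ (-α'⁻¹) := by positivity
        rw [mul_assoc]
        refine mul_le_mul_of_nonneg_left ?_ hK.le
        nlinarith
      simp only [hf, indicator_of_mem hyn]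
      rw [hWz, Real.norm_of_nonneg (by positivity), ← sq_abs]
      calc s n ^ (2 * α⁻¹) * |winsorized F (s n) (t n) z| ^ 2
          ≤ s n ^ (2 * α⁻¹) * (K * (1 + (1 / 2) ^ (-α'⁻¹)) * z ^ (-α⁻¹)) ^ 2 := by gcongr
        _ = (K * (1 + (1 / 2) ^ (-α'⁻¹))) ^ 2 * max 1 y ^ (-(2 * α⁻¹)) := by
          have hpos := Real.rpow_pos_of_pos hs0 (2 * α⁻¹)
          rw [mul_pow, hsq hz0, hz, Real.mul_rpow hs0.le (hmax y).le, mul_neg,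
            Real.rpow_neg hs0.le]
          field_simp
    · exact (integrableOn_max_one_rpow ha2).const_mul _
    · filter_upwards [ae_restrict_mem measurableSet_Ioi] with y hy
      have hy : 0 < y := hy
      have hs' := tendsto_nhdsWithin_iff.1 hs
      have hs0 : ∀ᶠ n in atTop, 0 < s n := hs'.2
      have hz : Tendsto (fun n => max (s n) (s n * max 1 y)) atTop (𝓝[>] 0) := by
        refine tendsto_nhdsWithin_iff.2 ⟨?_, ?_⟩
        · simpa using hs'.1.max (hs'.1.mul_const (max 1 y))
        · filter_upwards [hs0] with n hn
          exact lt_max_of_lt_left hn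
      have h := ((tendsto_rightLim_clampedQuantile_mul_rpow hF hc hα hL hsI htI hz
        (fun n => le_max_left _ _)).pow 2).mul_const (max 1 y ^ (-(2 * α⁻¹)))
      rw [neg_sq] at h
      refine h.congr' ?_
      have hsmall : ∀ᶠ n in atTop, s n * y < 1 / 2 := by
        have : Tendsto (fun n => s n * y) atTop (𝓝 0) := by simpa using hs'.1.mul_const y
        exact this.eventually (gt_mem_nhds (by norm_num))
      filter_upwards [hs0, htI, hsmall] with n hn htn hsy
      have hmem : y ∈ Ioc 0 (1 / (2 * s n)) := by
        refine ⟨hy, ?_⟩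
        rw [le_div_iff₀ (by positivity)]
        linarith
      simp only [hf, indicator_of_mem hmem]
      rw [max_eq_right (by nlinarith [le_max_left 1 y]), winsorized_mul hn (by linarith [htn.2]),
        mul_pow, hsq (mul_pos hn (hmax y)), Real.mul_rpow hn.le (hmax y).le,
        Real.rpow_neg (hmax y).le]
      have := Real.rpow_pos_of_pos (hmax y) (2 * α⁻¹)
      field_simp
  refine key.congr' ?_
  filter_upwards [hsI] with n hsn
  have hs0 := hsn.1
  have hfi : ∫ y in Ioi (0 : ℝ), f n y = ∫ y in (0 : ℝ)..1 / (2 * s n),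
      s n ^ (2 * α⁻¹) * winsorized F (s n) (t n) (s n * y) ^ 2 := by
    rw [intervalIntegral.integral_of_le (by positivity), hf, setIntegral_indicator
      measurableSet_Ioc, inter_eq_right.2 Ioc_subset_Ioi_self]
  rw [hfi, intervalIntegral.integral_const_mul, intervalIntegral.integral_comp_mul_left
    (fun x => winsorized F (s n) (t n) x ^ 2) hs0.ne', mul_zero,
    ← intervalIntegral.integral_of_le (by norm_num : (0 : ℝ) ≤ 1 / 2),
    show s n * (1 / (2 * s n)) = 1 / 2 by field_simp, Real.rpow_sub_one hs0.ne', smul_eq_mul]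
  ring

lemma integrableOn_one_sub_rpow {p : ℝ} (hp : -1 < p) :
    IntegrableOn (fun x : ℝ => (1 - x) ^ p) (Ioo 0 1) := by
  have h : IntervalIntegrable (fun x : ℝ => x ^ p) volume 0 1 :=
    intervalIntegral.intervalIntegrable_rpow' hp
  have h' := (h.comp_sub_left 1).symm
  simp only [sub_zero, sub_self] at h'
  exact ((intervalIntegrable_iff_integrableOn_Ioc_of_le zero_le_one).1 h').mono_set
    Ioo_subset_Ioc_self

lemma integrableOn_rpow_Ioo {p : ℝ} (hp : -1 < p) :
    IntegrableOn (fun x : ℝ => x ^ p) (Ioo 0 1) :=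
  ((intervalIntegrable_iff_integrableOn_Ioc_of_le zero_le_one).1
    (intervalIntegral.intervalIntegrable_rpow' hp)).mono_set Ioo_subset_Ioc_self

/-- The mean and the right half of the second moment of the winsorized quantile are bounded. -/
lemma exists_integral_winsorized_bounds {F : ℝ → ℝ} (hF : IsDistributionFunction F)
    {c α c' α' : ℝ} (hc : 0 < c) (hα : 1 < α)
    (hL : Tendsto (fun x : ℝ => F (-x) * x ^ α) atTop (𝓝 c)) (hc' : 0 < c') (hα' : 2 < α')
    (hR : Tendsto (fun x : ℝ => (1 - F x) * x ^ α') atTop (𝓝 c')) :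
    ∃ M : ℝ, ∀ s ∈ Ioo (0 : ℝ) (1 / 2), ∀ t ∈ Ioo (0 : ℝ) (1 / 2),
      |∫ x in Ioo (0 : ℝ) 1, winsorized F s t x| ≤ M ∧
      ∫ x in Ioo (1 / 2 : ℝ) 1, winsorized F s t x ^ 2 ≤ M := by
  have hα0 : 0 < α := one_pos.trans hα
  have hα'0 : 0 < α' := two_pos.trans hα'
  obtain ⟨K, hK, hbound⟩ := exists_abs_winsorized_le hF hc hα0 hL hc' hα'0 hR
  have ha0 : 0 < α⁻¹ := inv_pos.2 hα0
  have hb0 : 0 < α'⁻¹ := inv_pos.2 hα'0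
  have ha : α⁻¹ < 1 := inv_lt_one_of_one_lt₀ hα
  have hb : α'⁻¹ < 2⁻¹ := (inv_lt_inv₀ hα'0 two_pos).2 hα'
  set C : ℝ := (1 / 2) ^ (-α⁻¹) with hC
  have hC0 : 0 < C := by positivity
  set Φ : ℝ → ℝ := fun x => K * (x ^ (-α⁻¹) + (1 - x) ^ (-α'⁻¹)) with hΦ
  set Ψ : ℝ → ℝ := fun x => 2 * K ^ 2 * (C ^ 2 + (1 - x) ^ (-(2 * α'⁻¹))) with hΨ
  have hΦi : IntegrableOn Φ (Ioo 0 1) :=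
    ((integrableOn_rpow_Ioo (by linarith)).add
      (integrableOn_one_sub_rpow (by linarith))).const_mul K
  have hΨi : IntegrableOn Ψ (Ioo (1 / 2) 1) := by
    refine IntegrableOn.mono_set ?_ (Ioo_subset_Ioo_left (by norm_num : (0 : ℝ) ≤ 1 / 2))
    exact ((integrableOn_const (by simp)).add
      (integrableOn_one_sub_rpow (by linarith))).const_mul _
  refine ⟨max (∫ x in Ioo (0 : ℝ) 1, Φ x) (∫ x in Ioo (1 / 2 : ℝ) 1, Ψ x),
    fun s hs t ht => ⟨le_max_of_le_left ?_, le_max_of_le_right ?_⟩⟩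
  · rw [← Real.norm_eq_abs]
    refine norm_integral_le_of_norm_le hΦi ?_
    filter_upwards [ae_restrict_mem measurableSet_Ioo] with x hx
    exact hbound s hs t ht x hx
  · refine setIntegral_mono_on (integrable_winsorized_pow hF hs ht _ 2) hΨi measurableSet_Ioo
      fun x hx => ?_
    have hx0 : 0 < x := by linarith [hx.1]
    have hx1 : 0 < 1 - x := sub_pos.2 hx.2
    have h1 : x ^ (-α⁻¹) ≤ C :=
      Real.rpow_le_rpow_of_nonpos (by norm_num) hx.1.le (by linarith)
    have p1 := Real.rpow_pos_of_pos hx1 (-α'⁻¹)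
    have h2 : |winsorized F s t x| ≤ K * (C + (1 - x) ^ (-α'⁻¹)) :=
      (hbound s hs t ht x ⟨hx0, hx.2⟩).trans (by gcongr)
    have h3 : (1 - x) ^ (-(2 * α'⁻¹)) = ((1 - x) ^ (-α'⁻¹)) ^ 2 := by
      rw [← Real.rpow_natCast, ← Real.rpow_mul hx1.le]; push_cast; ring_nf
    calc winsorized F s t x ^ 2 = |winsorized F s t x| ^ 2 := (sq_abs _).symm
      _ ≤ (K * (C + (1 - x) ^ (-α'⁻¹))) ^ 2 := by gcongr
      _ ≤ Ψ x := by
        simp only [hΨ]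
        rw [h3]
        nlinarith [mul_nonneg (sq_nonneg K) (sq_nonneg (C - (1 - x) ^ (-α'⁻¹)))]

lemma tendsto_sigmaSq_div {F : ℝ → ℝ} (hF : IsDistributionFunction F) {c α c' α' : ℝ}
    (hc : 0 < c) (hα : 1 < α) (hα2 : α < 2)
    (hL : Tendsto (fun x : ℝ => F (-x) * x ^ α) atTop (𝓝 c)) (hc' : 0 < c') (hα' : 2 < α')
    (hR : Tendsto (fun x : ℝ => (1 - F x) * x ^ α') atTop (𝓝 c')) {s t : ℕ → ℝ}
    (hs : Tendsto s atTop (𝓝[>] 0)) (ht : Tendsto t atTop (𝓝[>] 0)) :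
    Tendsto (fun n => sigmaSq F (s n) (t n) / s n ^ (1 - 2 / α)) atTop
      (𝓝 (∫ y in Ioi (0 : ℝ), (c ^ α⁻¹) ^ 2 * max 1 y ^ (-(2 * α⁻¹)))) := by
  have hα0 : 0 < α := one_pos.trans hα
  obtain ⟨M, hM⟩ := exists_integral_winsorized_bounds hF hc hα hL hc' hα' hR
  have hsI : ∀ᶠ n in atTop, s n ∈ Ioo (0 : ℝ) (1 / 2) :=
    hs.eventually (Ioo_mem_nhdsGT (by norm_num))
  have htI : ∀ᶠ n in atTop, t n ∈ Ioo (0 : ℝ) (1 / 2) :=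
    ht.eventually (Ioo_mem_nhdsGT (by norm_num))
  have he : 0 < 2 * α⁻¹ - 1 := by
    have : 2⁻¹ < α⁻¹ := (inv_lt_inv₀ two_pos hα0).2 hα2
    linarith
  have hpow : Tendsto (fun n => s n ^ (2 * α⁻¹ - 1)) atTop (𝓝 0) := by
    have h := (tendsto_nhdsWithin_iff.1 hs).1.rpow_const (p := 2 * α⁻¹ - 1) (Or.inr he.le)
    rwa [Real.zero_rpow he.ne'] at h
  have hright : Tendsto (fun n => s n ^ (2 * α⁻¹ - 1) *
      ∫ x in Ioo (1 / 2 : ℝ) 1, winsorized F (s n) (t n) x ^ 2) atTop (𝓝 0) := by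
    refine bdd_le_mul_tendsto_zero' M ?_ hpow |>.congr fun n => mul_comm _ _
    filter_upwards [hsI, htI] with n hsn htn
    rw [abs_of_nonneg (integral_nonneg fun x => sq_nonneg _)]
    exact (hM _ hsn _ htn).2
  have hmean : Tendsto (fun n => s n ^ (2 * α⁻¹ - 1) *
      (∫ x in Ioo (0 : ℝ) 1, winsorized F (s n) (t n) x) ^ 2) atTop (𝓝 0) := by
    refine bdd_le_mul_tendsto_zero' (M ^ 2) ?_ hpow |>.congr fun n => mul_comm _ _
    filter_upwards [hsI, htI] with n hsn htn
    rw [abs_pow]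
    exact pow_le_pow_left₀ (abs_nonneg _) (hM _ hsn _ htn).1 2
  have hleft := tendsto_rpow_mul_integral_winsorized_sq hF hc hα0 hα2 hL hc' (two_pos.trans hα')
    hR hs ht
  have hsum := (hleft.add hright).sub hmean
  rw [add_zero, sub_zero] at hsum
  refine hsum.congr' ?_
  filter_upwards [hsI, htI] with n hsn htn
  have hsplit : ∫ x in Ioo (0 : ℝ) 1, winsorized F (s n) (t n) x ^ 2 =
      (∫ x in Ioc (0 : ℝ) (1 / 2), winsorized F (s n) (t n) x ^ 2) +
        ∫ x in Ioo (1 / 2 : ℝ) 1, winsorized F (s n) (t n) x ^ 2 := by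
    rw [← Ioc_union_Ioo_eq_Ioo (by norm_num : (0 : ℝ) ≤ 1 / 2) (by norm_num : (1 / 2 : ℝ) < 1)]
    refine setIntegral_union ?_ measurableSet_Ioo (integrable_winsorized_pow hF hsn htn _ 2)
      (integrable_winsorized_pow hF hsn htn _ 2)
    exact Set.disjoint_left.2 fun x hx hx' => absurd hx.2 (not_le.2 hx'.1)
  rw [sigmaSq_eq hF hsn htn, hsplit, show 1 - 2 / α = -(2 * α⁻¹ - 1) by ring,
    Real.rpow_neg hsn.1.le, div_inv_eq_mul]
  ring

lemma tendsto_div_nhdsGT_zero {m : ℕ → ℕ} (hm : Tendsto m atTop atTop)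
    (hm0 : Tendsto (fun n : ℕ => (m n : ℝ) / n) atTop (𝓝 0)) :
    Tendsto (fun n : ℕ => (m n : ℝ) / n) atTop (𝓝[>] 0) := by
  refine tendsto_nhdsWithin_iff.2 ⟨hm0, ?_⟩
  filter_upwards [hm.eventually_gt_atTop 0, eventually_gt_atTop 0] with n h1 h2
  exact div_pos (Nat.cast_pos.2 h1 : (0 : ℝ) < m n) (Nat.cast_pos.2 h2 : (0 : ℝ) < n)

/-- under the second-order tail conditions with `α_R > 2` and `α_L < 2`,
there is a strictly positive finite constant `C_L`, depending only on `c_L` and `α_L`,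
such that `σ²(m/n, k/n) / (m/n)^(1 - 2/α_L) → C_L` as `n → ∞`. -/
theorem sigmaSq_ratio_tendsto_of_gt_two_lt_two
    (cL αL : ℝ) (hcL : 0 < cL) (hαL1 : 1 < αL) (hαL2 : αL < 2) :
    ∃ CL : ℝ, 0 < CL ∧
      ∀ (F : ℝ → ℝ) (cR bR bL αR βR βL : ℝ) (m k : ℕ → ℕ),
        IsDistributionFunction F →
        0 < cR → bR ≠ 0 → bL ≠ 0 → 0 < βR → 0 < βL → 1 < αR →
        RightTailSecondOrder F cR αR bR βR →
        LeftTailSecondOrder F cL αL bL βL →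
        2 < αR →
        Tendsto m atTop atTop →
        Tendsto (fun n : ℕ => (m n : ℝ) / n) atTop (nhds 0) →
        Tendsto k atTop atTop →
        Tendsto (fun n : ℕ => (k n : ℝ) / n) atTop (nhds 0) →
        Tendsto
          (fun n : ℕ =>
            sigmaSq F ((m n : ℝ) / n) ((k n : ℝ) / n) /
              ((m n : ℝ) / n) ^ (1 - 2 / αL))
          atTop (nhds CL) := by

  refine ⟨∫ y in Ioi (0 : ℝ), (cL ^ αL⁻¹) ^ 2 * max 1 y ^ (-(2 * αL⁻¹)), ?_, ?_⟩
  · have hp : -(2 * αL⁻¹) < -1 := by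
      have : 2⁻¹ < αL⁻¹ := (inv_lt_inv₀ two_pos (by linarith)).2 hαL2
      linarith
    rw [integral_const_mul]
    have := integral_max_one_rpow_pos hp
    positivity
  · intro F cR bR bL αR βR βL m k hF hcR _ _ hβR hβL _ hR hL hαR hm hm0 hk hk0
    exact tendsto_sigmaSq_div hF hcL hαL1 hαL2
      (tendsto_mul_rpow_of_secondOrder (T := fun x => F (-x)) hcL hβL hL) hcR hαR
      (tendsto_mul_rpow_of_secondOrder (T := fun x => 1 - F x) hcR hβR hR)
      (tendsto_div_nhdsGT_zero hm hm0) (tendsto_div_nhdsGT_zero hk hk0)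
end
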